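/- arXiv:1610.01287 — 2 statements merged into one kernel-verified Lean document; each statement's English description precedes it below -/
import Mathlib

section
/- Consider the binary-input channel CEF(p_{Z|X}, p_e, p_w) with erasing and flipping adversary, and let H(X|Z) be the conditional entropy of X given Z when X is uniform on {0,1} and Z is the output of the memoryless channel p_{Z|X}. Then every secrecy rate R with R < H(X|Z) + p_e·H(p_w/(1−p_e)) − p_e − H(p_w/(1−p_e)) is securely achievable. In particular, when p_{Z|X} is the binary erasure channel BEC(q), every secrecy rate R < q + p_e·H(p_w/(1−p_e)) − p_e − H(p_w/(1−p_e)) is securely achievable. -/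
open scoped BigOperators

/-- Binary entropy function (in bits). -/
noncomputable def binH (t : ℝ) : ℝ := -t * Real.logb 2 t - (1 - t) * Real.logb 2 (1 - t)

/-- Number of erasures (`⊥` symbols, encoded as `none`) in a state vector. -/
def numErase {n : ℕ} (s : Fin n → Option Bool) : ℕ :=
  (Finset.univ.filter fun t => s t = none).card

/-- Number of flips (`1` symbols, encoded as `some true`) in a state vector. -/
def numFlip {n : ℕ} (s : Fin n → Option Bool) : ℕ :=
  (Finset.univ.filter fun t => s t = some true).card

/-- Bob's received word on the channel with erasing and flipping adversary:
`Y_t = ⊥` if `s_t = ⊥` and `Y_t = X_t ⊕ s_t` otherwise. -/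
def cefOut {n : ℕ} (x : Fin n → Bool) (s : Fin n → Option Bool) : Fin n → Option Bool :=
  fun t => (s t).map fun b => xor (x t) b

/-- `n`-letter law of the memoryless channel `p_{Z|X}` from Alice to James. -/
noncomputable def chanZn {𝒵 : Type*} [Fintype 𝒵] (pZ : Bool → 𝒵 → ℝ) {n : ℕ}
    (x : Fin n → Bool) (z : Fin n → 𝒵) : ℝ :=
  ∏ t, pZ (x t) (z t)

/-- `p` is a conditional probability mass function (a channel). -/
def IsCondPMF {α β : Type*} [Fintype β] (p : α → β → ℝ) : Prop :=
  ∀ a, (∀ b, 0 ≤ p a b) ∧ ∑ b, p a b = 1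

/-- Shannon entropy (in bits) of a mass function on a finite type. -/
noncomputable def ent {α : Type*} [Fintype α] (P : α → ℝ) : ℝ :=
  -∑ a, P a * Real.logb 2 (P a)

/-- `H(X|Z)` (in bits) when `X` is uniform on `{0,1}` and `Z` is the output of the
memoryless channel `p_{Z|X}` on input `X`. -/
noncomputable def HXgZunif {𝒵 : Type*} [Fintype 𝒵] (pZ : Bool → 𝒵 → ℝ) : ℝ :=
  ent (fun xz : Bool × 𝒵 => (1 / 2 : ℝ) * pZ xz.1 xz.2)
    - ent (fun z : 𝒵 => ∑ x, (1 / 2 : ℝ) * pZ x z)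

/-- A jamming strategy for `CEF(p_{Z|X}, p_e, p_w)`: to each observation `z^n` it assigns
a probability distribution over state vectors with at most `p_e·n` erasures and at most
`p_w·n` flips. -/
structure JammerCEF (𝒵 : Type*) [Fintype 𝒵] (pe pw : ℝ) (n : ℕ) where
  J : (Fin n → 𝒵) → (Fin n → Option Bool) → ℝ
  nonneg : ∀ z s, 0 ≤ J z s
  sum_one : ∀ z, ∑ s, J z s = 1
  supp : ∀ z s, J z s ≠ 0 → (numErase s : ℝ) ≤ pe * n ∧ (numFlip s : ℝ) ≤ pw * n

/-- A (possibly stochastic) encoder: to each message it assigns a probability distribution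
over codewords in `{0,1}^n`. -/
structure StochEnc (n K : ℕ) where
  E : Fin K → (Fin n → Bool) → ℝ
  nonneg : ∀ u x, 0 ≤ E u x
  sum_one : ∀ u, ∑ x, E u x = 1

/-- Mutual information (in bits) of a joint probability mass function `P` on `α × β`. -/
noncomputable def miBits {α β : Type*} [Fintype α] [Fintype β] (P : α → β → ℝ) : ℝ :=
  ∑ a, ∑ b, P a b * Real.logb 2 (P a b / ((∑ b', P a b') * (∑ a', P a' b)))

/-- Joint distribution of the uniform message `U` and James's view `Z^n` induced by a
stochastic encoder and the memoryless channel `p_{Z|X}`. -/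
noncomputable def jointUZ {𝒵 : Type*} [Fintype 𝒵] (pZ : Bool → 𝒵 → ℝ) {n K : ℕ}
    (E : StochEnc n K) : Fin K → (Fin n → 𝒵) → ℝ :=
  fun u z => (1 / (K : ℝ)) * ∑ x, E.E u x * chanZn pZ x z

/-- Average error probability of a (possibly stochastic) code against a jamming strategy
on `CEF(p_{Z|X}, p_e, p_w)`. -/
noncomputable def avgErrCEF {𝒵 : Type*} [Fintype 𝒵] (pZ : Bool → 𝒵 → ℝ) {n K : ℕ}
    (E : StochEnc n K) (Dec : (Fin n → Option Bool) → Fin K)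
    (J : (Fin n → 𝒵) → (Fin n → Option Bool) → ℝ) : ℝ :=
  (1 / (K : ℝ)) * ∑ u, ∑ x, E.E u x * ∑ z, ∑ s,
    chanZn pZ x z * J z s * (if Dec (cefOut x s) = u then 0 else 1)

/-- `R` is a securely achievable rate for `CEF(p_{Z|X}, p_e, p_w)`: reliable against every
jamming strategy, and `(1/n)·I(Z^n;U) ≤ ε`. -/
def SecurelyAchievableCEF {𝒵 : Type*} [Fintype 𝒵] (pZ : Bool → 𝒵 → ℝ)
    (pe pw R : ℝ) : Prop :=
  ∀ ε > (0 : ℝ), ∃ (n K : ℕ) (E : StochEnc n K)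
    (Dec : (Fin n → Option Bool) → Fin K),
    0 < n ∧ 0 < K ∧ (2 : ℝ) ^ (R * n) ≤ (K : ℝ) ∧
    (∀ Jm : JammerCEF 𝒵 pe pw n, avgErrCEF pZ E Dec Jm.J ≤ ε) ∧
    (1 / (n : ℝ)) * miBits (jointUZ pZ E) ≤ ε

/-- The binary erasure channel `BEC(q)` as a single-letter channel from `Bool`
to `Option Bool` (with `none` the erasure symbol). -/
noncomputable def becChan (q : ℝ) : Bool → Option Bool → ℝ :=
  fun x z => Option.elim z q (fun b => if b = x then 1 - q else 0)

/-- Linear upper bound for the exponential on the unit interval. -/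
lemma exp_le_one_add_two_mul {g : ℝ} (h0 : 0 ≤ g) (h1 : g ≤ 1) :
    Real.exp g ≤ 1 + 2 * g := by
  have h := Real.abs_exp_sub_one_sub_id_le (x := g) (by rw [abs_of_nonneg h0]; exact h1)
  have h' := (abs_le.mp h).2
  nlinarith

open Classical in
/-- The number of points of a finite type satisfying a predicate, as a real number. -/
noncomputable def cnt {Ω : Type*} [Fintype Ω] (P : Ω → Prop) : ℝ :=
  ((Finset.univ.filter P).card : ℝ)

lemma cnt_eq_sum {Ω : Type*} [Fintype Ω] (P : Ω → Prop) [DecidablePred P] :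
    cnt P = ∑ ω, if P ω then (1 : ℝ) else 0 := by
  classical
  unfold cnt
  rw [Finset.sum_boole]
  congr!

lemma cnt_or_le {Ω : Type*} [Fintype Ω] (P Q : Ω → Prop) :
    cnt (fun ω => P ω ∨ Q ω) ≤ cnt P + cnt Q := by
  classical
  simp only [cnt_eq_sum, ← Finset.sum_add_distrib]
  refine Finset.sum_le_sum fun ω _ => ?_
  by_cases hP : P ω <;> by_cases hQ : Q ω <;> simp [hP, hQ]

lemma cnt_exists_le {Ω ι : Type*} [Fintype Ω] [Fintype ι] (P : ι → Ω → Prop) (b : ℝ)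
    (h : ∀ i, cnt (P i) ≤ b) :
    cnt (fun ω => ∃ i, P i ω) ≤ Fintype.card ι * b := by
  classical
  have h1 : cnt (fun ω => ∃ i, P i ω) ≤ ∑ i, cnt (P i) := by
    simp only [cnt_eq_sum]
    rw [Finset.sum_comm]
    refine Finset.sum_le_sum fun ω _ => ?_
    have hnn : ∀ i ∈ Finset.univ, (0 : ℝ) ≤ if P i ω then 1 else 0 := by
      intro i _
      split_ifs <;> norm_num
    split_ifs with hω
    · obtain ⟨i, hi⟩ := hω
      have h2 := Finset.single_le_sum hnn (Finset.mem_univ i)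
      rwa [if_pos hi] at h2
    · exact Finset.sum_nonneg hnn
  refine h1.trans ((Finset.sum_le_sum fun i _ => h i).trans ?_)
  simp

lemma exists_not_of_cnt_lt {Ω : Type*} [Fintype Ω] (P : Ω → Prop)
    (h : cnt P < Fintype.card Ω) : ∃ ω, ¬ P ω := by
  classical
  by_contra! hc
  unfold cnt at h
  rw [Finset.filter_true_of_mem fun ω _ => hc ω] at h
  simp at h

/-- Markov's inequality for the counting measure, in exponential form. -/
lemma cnt_lt_le_exp {Ω : Type*} [Fintype Ω] (F : Ω → ℝ) (τ B : ℝ)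
    (h : ∑ ω, Real.exp (F ω) ≤ B) : cnt (fun ω => τ < F ω) ≤ B * Real.exp (-τ) := by
  classical
  rw [cnt_eq_sum]
  calc ∑ ω, (if τ < F ω then (1 : ℝ) else 0) ≤ ∑ ω, Real.exp (F ω) * Real.exp (-τ) := by
        refine Finset.sum_le_sum fun ω _ => ?_
        rw [← Real.exp_add]
        split_ifs with hω
        · exact Real.one_le_exp (by linarith)
        · exact (Real.exp_pos _).le
    _ = (∑ ω, Real.exp (F ω)) * Real.exp (-τ) := by rw [Finset.sum_mul]
    _ ≤ _ := by gcongr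

/-- Markov's inequality for an average over random codebooks. -/
lemma cnt_sum_gt_le {X ι : Type*} [Fintype X] [Fintype ι] [DecidableEq ι] (a : X → ℝ)
    (ha : ∀ x, 0 ≤ a x) (α : ℝ) (hα : 0 < α) (hmean : ∑ x, a x ≤ α * Fintype.card X)
    (hι : 0 < Fintype.card ι) :
    cnt (fun c : ι → X => 4 * α * Fintype.card ι < ∑ i, a (c i))
      ≤ (Fintype.card X : ℝ) ^ Fintype.card ι * (1 / 4) := by
  classical
  have key : ∀ i : ι, ∑ c : ι → X, a (c i) ≤ (Fintype.card X : ℝ) ^ Fintype.card ι * α := by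
    intro i
    have h1 : ∀ c : ι → X, a (c i) = ∏ k, (if k = i then a (c k) else 1) := by
      intro c
      rw [Finset.prod_ite_eq' Finset.univ i]; simp
    simp_rw [h1]
    have h2 := Finset.prod_univ_sum (fun _ : ι => (Finset.univ : Finset X))
      (fun k x => if k = i then a x else 1)
    rw [Fintype.piFinset_univ] at h2
    rw [← h2]
    calc ∏ k, ∑ x, (if k = i then a x else 1)
        ≤ ∏ k : ι, ((Fintype.card X : ℝ) * (if k = i then α else 1)) := by
          refine Finset.prod_le_prod (fun k _ => Finset.sum_nonneg fun x _ => ?_) fun k _ => ?_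
          · split_ifs
            · exact ha x
            · exact zero_le_one
          · split_ifs
            · linarith
            · simp
      _ = _ := by
          rw [Finset.prod_mul_distrib, Finset.prod_ite_eq' Finset.univ i]
          simp
  have hsum : ∑ c : ι → X, ∑ i, a (c i)
      ≤ Fintype.card ι * ((Fintype.card X : ℝ) ^ Fintype.card ι * α) := by
    rw [Finset.sum_comm]
    refine (Finset.sum_le_sum fun i _ => key i).trans ?_
    simp
  have hc : (0 : ℝ) < Fintype.card ι := by exact_mod_cast hι
  have hB : 0 < 4 * α * Fintype.card ι := by positivity
  have hle : cnt (fun c : ι → X => 4 * α * Fintype.card ι < ∑ i, a (c i))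
      * (4 * α * Fintype.card ι) ≤ ∑ c : ι → X, ∑ i, a (c i) := by
    rw [cnt_eq_sum, Finset.sum_mul]
    refine Finset.sum_le_sum fun c _ => ?_
    split_ifs with h
    · linarith
    · rw [zero_mul]; exact Finset.sum_nonneg fun i _ => ha _
  rw [← mul_le_mul_iff_left₀ hB]
  refine hle.trans (hsum.trans (le_of_eq ?_))
  ring

/-- Chernoff bound for a block of coordinates of a uniformly random codebook. -/
lemma cnt_block_sum_gt_le {X ι : Type*} [Fintype X] [Fintype ι] [DecidableEq ι] (h : X → ℝ)
    (m μ : ℝ) (hm : 0 < m) (h0 : ∀ x, 0 ≤ h x) (h1 : ∀ x, h x ≤ m)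
    (hmean : ∑ x, h x ≤ μ * Fintype.card X) (I : Finset ι) (τ : ℝ) :
    cnt (fun c : ι → X => τ < ∑ i ∈ I, h (c i))
      ≤ (Fintype.card X : ℝ) ^ Fintype.card ι * Real.exp ((2 * I.card * μ - τ) / m) := by
  classical
  have hexp : ∑ c : ι → X, Real.exp (∑ i ∈ I, h (c i) / m)
      ≤ (Fintype.card X : ℝ) ^ Fintype.card ι * Real.exp (2 * I.card * μ / m) := by
    have e1 : ∀ c : ι → X, Real.exp (∑ i ∈ I, h (c i) / m)
        = ∏ k, (if k ∈ I then Real.exp (h (c k) / m) else 1) := by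
      intro c
      rw [Real.exp_sum, Finset.prod_ite_mem, Finset.univ_inter]
    simp_rw [e1]
    have h2 := Finset.prod_univ_sum (fun _ : ι => (Finset.univ : Finset X))
      (fun k x => if k ∈ I then Real.exp (h x / m) else 1)
    rw [Fintype.piFinset_univ] at h2
    rw [← h2]
    calc ∏ k, ∑ x, (if k ∈ I then Real.exp (h x / m) else 1)
        ≤ ∏ k : ι, ((Fintype.card X : ℝ) * (if k ∈ I then Real.exp (2 * μ / m) else 1)) := by
          refine Finset.prod_le_prod (fun k _ => Finset.sum_nonneg fun x _ => ?_) fun k _ => ?_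
          · split_ifs
            · exact (Real.exp_pos _).le
            · exact zero_le_one
          · split_ifs
            · calc ∑ x, Real.exp (h x / m) ≤ ∑ x, (1 + 2 * (h x / m)) :=
                    Finset.sum_le_sum fun x _ => exp_le_one_add_two_mul
                      (div_nonneg (h0 x) hm.le) ((div_le_one hm).2 (h1 x))
                _ = Fintype.card X + 2 / m * ∑ x, h x := by
                    rw [Finset.sum_add_distrib, Finset.mul_sum]
                    simp only [Finset.sum_const, Finset.card_univ, nsmul_eq_mul, mul_one]
                    congr 1
                    exact Finset.sum_congr rfl fun x _ => by ring
                _ ≤ Fintype.card X + 2 / m * (μ * Fintype.card X) := by gcongr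
                _ = Fintype.card X * (2 * μ / m + 1) := by ring
                _ ≤ _ := by gcongr; exact Real.add_one_le_exp _
            · simp
      _ = _ := by
          rw [Finset.prod_mul_distrib, Finset.prod_ite_mem, Finset.univ_inter,
            Finset.prod_const, Finset.prod_const, ← Real.exp_nat_mul, Finset.card_univ]
          congr 2
          ring
  have hmk := cnt_lt_le_exp (fun c : ι → X => ∑ i ∈ I, h (c i) / m) (τ / m) _ hexp
  have hiff : (fun c : ι → X => τ < ∑ i ∈ I, h (c i))
      = fun c : ι → X => τ / m < ∑ i ∈ I, h (c i) / m := by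
    funext c
    rw [← Finset.sum_div, div_lt_div_iff_of_pos_right hm]
  rw [hiff]
  refine hmk.trans (le_of_eq ?_)
  rw [mul_assoc, ← Real.exp_add]
  congr 2
  ring

/-- A nonnegative-drift bound along the coordinates of a tuple propagates to the full sum. -/
lemma sum_le_of_snoc_step {X : Type*} [Fintype X] (G : ∀ k : ℕ, (Fin k → X) → ℝ)
    (hG : ∀ k p, ∑ x, G (k + 1) (Fin.snoc p x) ≤ Fintype.card X * G k p) (N : ℕ) :
    ∑ c : Fin N → X, G N c ≤ (Fintype.card X : ℝ) ^ N * G 0 Fin.elim0 := by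
  induction N with
  | zero => 
    simp only [Finset.univ_unique, Finset.sum_singleton, pow_zero, one_mul]
    exact le_of_eq (congrArg _ (Subsingleton.elim _ _))
  | succ k ih =>
    rw [← (Fin.snocEquiv fun _ : Fin (k + 1) => X).sum_comp, Fintype.sum_prod_type_right]
    calc ∑ p : Fin k → X, ∑ x, G (k + 1) (Fin.snoc p x)
        ≤ ∑ p : Fin k → X, Fintype.card X * G k p := Finset.sum_le_sum fun p _ => hG k p
      _ = Fintype.card X * ∑ p : Fin k → X, G k p := by rw [Finset.mul_sum]
      _ ≤ Fintype.card X * ((Fintype.card X : ℝ) ^ k * G 0 Fin.elim0) := by gcongr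
      _ = _ := by ring

open Classical in
/-- Exponential supermartingale bound: in a random codebook, the `f`-weight of the codewords
that are confusable with an earlier one is controlled by the `f`-weight of the confusability
regions of the earlier codewords. -/
lemma cnt_confusable_gt_le {X : Type*} [Fintype X] [Nonempty X] (f : X → ℝ) (M : ℝ)
    (hM : 0 < M) (f0 : ∀ x, 0 ≤ f x) (f1 : ∀ x, f x ≤ M) (D : X → X → Prop) (h : X → ℝ)
    (hh : ∀ x', h x' = (∑ x, if D x x' then f x else 0) / Fintype.card X) (N : ℕ) (τ : ℝ) :
    cnt (fun c : Fin N → X => τ < ∑ i, ((if ∃ j, j < i ∧ D (c i) (c j) then f (c i) / M else 0)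
        - 2 / M * ∑ j, if j < i then h (c j) else 0))
      ≤ (Fintype.card X : ℝ) ^ N * Real.exp (-τ) := by
  have hX : (0 : ℝ) < Fintype.card X := by exact_mod_cast Fintype.card_pos
  let F : ∀ k : ℕ, (Fin k → X) → ℝ := fun k c =>
    ∑ i, ((if ∃ j, j < i ∧ D (c i) (c j) then f (c i) / M else 0)
        - 2 / M * ∑ j, if j < i then h (c j) else 0)
  have hstep : ∀ k (p : Fin k → X) (x : X), F (k + 1) (Fin.snoc p x)
      = F k p + ((if ∃ j, D x (p j) then f x / M else 0) - 2 / M * ∑ j, h (p j)) := by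
    intro k p x
    simp only [F]
    rw [Fin.sum_univ_castSucc]
    congr 1
    · refine Finset.sum_congr rfl fun i _ => ?_
      refine congrArg₂ (· - ·) ?_ (congrArg (2 / M * ·) ?_)
      · have hi : ¬ Fin.last k < i.castSucc := not_lt.2 (Fin.le_last _)
        simp [Fin.exists_fin_succ', hi]
      · rw [Fin.sum_univ_castSucc]
        simp [Fin.snoc_castSucc, Fin.le_last]
    · refine congrArg₂ (· - ·) ?_ (congrArg (2 / M * ·) ?_)
      · simp [Fin.exists_fin_succ', Fin.snoc_castSucc, Fin.snoc_last, Fin.castSucc_lt_last]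
      · rw [Fin.sum_univ_castSucc]
        simp [Fin.snoc_castSucc, Fin.castSucc_lt_last]
  have hsum : ∑ c : Fin N → X, Real.exp (F N c) ≤ (Fintype.card X : ℝ) ^ N := by
    have := sum_le_of_snoc_step (X := X) (fun k c => Real.exp (F k c)) ?_ N
    · refine this.trans (le_of_eq ?_)
      simp [F]
    · intro k p
      simp only [hstep, Real.exp_add, Real.exp_sub, ← Finset.mul_sum, ← Finset.sum_div]
      rw [mul_comm]
      gcongr
      rw [div_le_iff₀ (Real.exp_pos _)]
      calc ∑ x, Real.exp (if ∃ j, D x (p j) then f x / M else 0)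
          ≤ ∑ x, (1 + 2 / M * ∑ j, if D x (p j) then f x else 0) := by
            refine Finset.sum_le_sum fun x _ => ?_
            have hnn : ∀ j ∈ Finset.univ, 0 ≤ if D x (p j) then f x else 0 := by
              intro j _
              split_ifs
              · exact f0 x
              · exact le_rfl
            split_ifs with hx
            · obtain ⟨j, hj⟩ := hx
              have h1 := exp_le_one_add_two_mul (div_nonneg (f0 x) hM.le)
                ((div_le_one hM).2 (f1 x))
              have h2 := Finset.single_le_sum hnn (Finset.mem_univ j)
              rw [if_pos hj] at h2
              calc _ ≤ _ := h1
                _ = 1 + 2 / M * f x := by ring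
                _ ≤ _ := by gcongr
            · rw [Real.exp_zero]
              have := Finset.sum_nonneg hnn
              have : 0 ≤ 2 / M * ∑ j, if D x (p j) then f x else 0 := by positivity
              linarith
        _ = Fintype.card X * (2 / M * ∑ j, h (p j) + 1) := by
            rw [Finset.sum_add_distrib, ← Finset.mul_sum, Finset.sum_comm]
            simp only [hh, ← Finset.sum_div, Finset.sum_const, Finset.card_univ, nsmul_eq_mul]
            field_simp
            ring
        _ ≤ _ := by gcongr; exact Real.add_one_le_exp _
  exact cnt_lt_le_exp (F N) τ _ hsum

open Classical in
/-- Random coding: some codebook simultaneously has a small average of `a`, spreads every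
weight `f z` evenly over the messages, and has little `f z`-weight on codewords confusable with
an earlier one. -/
lemma exists_codebook {X Z S : Type*} [Fintype X] [Nonempty X] [Fintype Z] [Fintype S]
    (f : Z → X → ℝ) (a : X → ℝ) (D : S → X → X → Prop) (M β α η : ℝ) (K L : ℕ)
    (hK : 0 < K) (hL : 0 < L) (hM : 0 < M) (hβ : 0 < β) (hα : 0 < α)
    (f0 : ∀ z x, 0 ≤ f z x) (f1 : ∀ z x, f z x ≤ M) (fmean : ∀ z, ∑ x, f z x ≤ Fintype.card X)
    (a0 : ∀ x, 0 ≤ a x) (amean : ∑ x, a x ≤ α * Fintype.card X)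
    (D1 : ∀ s x', cnt (fun x => D s x x') ≤ β * Fintype.card X)
    (D2 : ∀ s x, cnt (fun x' => D s x x') ≤ β * Fintype.card X)
    (hnum : (Fintype.card Z : ℝ) * (K * Real.exp (-(2 * L / M)))
      + Fintype.card Z * (Fintype.card S * (Real.exp ((2 * (K * L) * β - η) / (M * β))
        + Real.exp (-(K * L * η / M)))) < 3 / 4) :
    ∃ c : Fin (K * L) → X, (∑ i, a (c i) ≤ 4 * α * (K * L)) ∧
      (∀ z u, ∑ w : Fin L, f z (c (finProdFinEquiv (u, w))) ≤ 4 * L) ∧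
      ∀ z s, ∑ i, (if ∃ j, j < i ∧ D s (c i) (c j) then f z (c i) else 0)
        ≤ 3 * η * (K * L) := by
  have hX : (0 : ℝ) < Fintype.card X := by exact_mod_cast Fintype.card_pos
  have hN : (0 : ℝ) < (K : ℝ) * L := by positivity
  let h : Z → S → X → ℝ := fun z s x' =>
    (∑ x, if D s x x' then f z x else 0) / Fintype.card X
  have h0 : ∀ z s x', 0 ≤ h z s x' := fun z s x' => div_nonneg
    (Finset.sum_nonneg fun x _ => by split_ifs; exacts [f0 z x, le_rfl]) hX.le
  have h1 : ∀ z s x', h z s x' ≤ M * β := by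
    intro z s x'
    rw [div_le_iff₀ hX, mul_assoc]
    refine le_trans ?_ (mul_le_mul_of_nonneg_left (D1 s x') hM.le)
    rw [cnt_eq_sum, Finset.mul_sum]
    refine Finset.sum_le_sum fun x _ => ?_
    split_ifs
    · simpa using f1 z x
    · simp
  have hmean : ∀ z s, ∑ x', h z s x' ≤ β * Fintype.card X := by
    intro z s
    simp only [h]
    rw [← Finset.sum_div, div_le_iff₀ hX, Finset.sum_comm]
    calc ∑ x, ∑ x', (if D s x x' then f z x else 0)
        = ∑ x, f z x * cnt (fun x' => D s x x') := by
          refine Finset.sum_congr rfl fun x _ => ?_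
          rw [cnt_eq_sum, Finset.mul_sum]
          simp
      _ ≤ ∑ x, f z x * (β * Fintype.card X) := by
          gcongr with x
          · exact f0 z x
          · exact D2 s x
      _ = (β * Fintype.card X) * ∑ x, f z x := by rw [Finset.mul_sum]; simp [mul_comm]
      _ ≤ _ := by gcongr; exact fmean z
  let P1 : (Fin (K * L) → X) → Prop := fun c => 4 * α * (K * L) < ∑ i, a (c i)
  let P2 : Z × Fin K → (Fin (K * L) → X) → Prop := fun p c =>
    4 * (L : ℝ) < ∑ w : Fin L, f p.1 (c (finProdFinEquiv (p.2, w)))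
  let P3 : Z × S → (Fin (K * L) → X) → Prop := fun p c => η < ∑ i, h p.1 p.2 (c i)
  let P4 : Z × S → (Fin (K * L) → X) → Prop := fun p c => K * L * η / M <
    ∑ i, ((if ∃ j, j < i ∧ D p.2 (c i) (c j) then f p.1 (c i) / M else 0)
        - 2 / M * ∑ j, if j < i then h p.1 p.2 (c j) else 0)
  have b1 : cnt P1 ≤ (Fintype.card X : ℝ) ^ (K * L) * (1 / 4) := by
    have := cnt_sum_gt_le (ι := Fin (K * L)) a a0 α hα amean (by rw [Fintype.card_fin]; positivity)
    simpa [P1] using this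
  have b2 : ∀ p, cnt (P2 p) ≤ (Fintype.card X : ℝ) ^ (K * L) * Real.exp (-(2 * L / M)) := by
    rintro ⟨z, u⟩
    have := cnt_block_sum_gt_le (ι := Fin (K * L)) (f z) M 1 hM (f0 z) (f1 z)
      (by simpa using fmean z)
      (Finset.univ.map ⟨fun w : Fin L => finProdFinEquiv (u, w), fun w w' hw => by simpa using hw⟩)
      (4 * L)
    simp only [Finset.sum_map, Finset.card_map, Finset.card_univ,
      Fintype.card_fin] at this
    refine this.trans (le_of_eq ?_)
    congr 2
    ring
  have b3 : ∀ p, cnt (P3 p) ≤ (Fintype.card X : ℝ) ^ (K * L)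
      * Real.exp ((2 * (K * L) * β - η) / (M * β)) := by
    rintro ⟨z, s⟩
    have := cnt_block_sum_gt_le (ι := Fin (K * L)) (h z s) (M * β) β (by positivity) (h0 z s)
      (h1 z s) (hmean z s) Finset.univ η
    simpa using this
  have b4 : ∀ p, cnt (P4 p) ≤ (Fintype.card X : ℝ) ^ (K * L) * Real.exp (-(K * L * η / M)) :=
    fun p => cnt_confusable_gt_le (f p.1) M hM (f0 p.1) (f1 p.1) (D p.2) (h p.1 p.2)
      (fun x' => rfl) (K * L) _
  obtain ⟨c, hc⟩ := exists_not_of_cnt_lt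
    (fun c => (P1 c ∨ ∃ p, P2 p c) ∨ ((∃ p, P3 p c) ∨ ∃ p, P4 p c)) (by
      refine lt_of_le_of_lt ((cnt_or_le _ _).trans (add_le_add
        ((cnt_or_le _ _).trans (add_le_add b1 (cnt_exists_le P2 _ b2)))
        ((cnt_or_le _ _).trans (add_le_add (cnt_exists_le P3 _ b3) (cnt_exists_le P4 _ b4))))) ?_
      have hp : (0 : ℝ) < (Fintype.card X : ℝ) ^ (K * L) := by positivity
      have := mul_lt_mul_of_pos_left hnum hp
      simp only [Fintype.card_prod, Fintype.card_fin, Fintype.card_fun, Nat.cast_mul, Nat.cast_pow]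
      nlinarith)
  push Not at hc
  obtain ⟨⟨hc1, hc2⟩, hc3, hc4⟩ := hc
  refine ⟨c, not_lt.1 hc1, fun z u => not_lt.1 (hc2 (z, u)), fun z s => ?_⟩
  have e3 : ∑ i, h z s (c i) ≤ η := not_lt.1 (hc3 (z, s))
  have e4 := not_lt.1 (hc4 (z, s))
  simp only at e4
  rw [Finset.sum_sub_distrib, ← Finset.mul_sum] at e4
  have e5 : ∑ i : Fin (K * L), ∑ j, (if j < i then h z s (c j) else 0) ≤ K * L * η := by
    calc _ ≤ ∑ i : Fin (K * L), η := by
          refine Finset.sum_le_sum fun i _ => le_trans (Finset.sum_le_sum fun j _ => ?_) e3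
          split_ifs
          exacts [le_rfl, h0 _ _ _]
      _ = _ := by simp
  have e6 : ∑ i, (if ∃ j, j < i ∧ D s (c i) (c j) then f z (c i) / M else 0)
      = (∑ i, (if ∃ j, j < i ∧ D s (c i) (c j) then f z (c i) else 0)) / M := by
    rw [Finset.sum_div]
    refine Finset.sum_congr rfl fun i _ => ?_
    split_ifs <;> simp
  rw [e6] at e4
  have e7 := mul_le_mul_of_nonneg_left e5 (show 0 ≤ 2 / M by positivity)
  have e8 : (∑ i, (if ∃ j, j < i ∧ D s (c i) (c j) then f z (c i) else 0)) / M
      ≤ (3 * η * (K * L)) / M := by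
    calc _ ≤ K * L * η / M + 2 / M * (K * L * η) := by linarith
      _ = _ := by ring
  exact (div_le_div_iff_of_pos_right hM).1 e8

lemma binH_eq (t : ℝ) : binH t = Real.binEntropy t / Real.log 2 := by
  unfold binH Real.logb
  rw [Real.binEntropy_eq_negMulLog_add_negMulLog_one_sub]
  unfold Real.negMulLog
  ring

lemma binH_nonneg {t : ℝ} (h0 : 0 ≤ t) (h1 : t ≤ 1) : 0 ≤ binH t := by
  rw [binH_eq]
  exact div_nonneg (Real.binEntropy_nonneg h0 h1) (Real.log_nonneg one_le_two)

lemma binH_le_one (t : ℝ) : binH t ≤ 1 := by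
  rw [binH_eq, div_le_one (Real.log_pos one_lt_two)]
  exact Real.binEntropy_le_log_two

lemma two_rpow_neg_mul_binH_le (p : ℝ) (hp0 : 0 ≤ p) (hp : p ≤ 1 / 2) (k r : ℕ)
    (hk : (k : ℝ) ≤ p * (k + r)) :
    (2 : ℝ) ^ (-((k + r) * binH p)) ≤ p ^ k * (1 - p) ^ r := by
  rcases hp0.eq_or_lt with rfl | hp0
  · have : k = 0 := by simpa using hk
    subst this
    simp [binH]
  · have h1 : 0 < 1 - p := by linarith
    have h2 : 0 < Real.log 2 := Real.log_pos one_lt_two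
    rw [Real.rpow_def_of_pos two_pos, ← Real.rpow_natCast, ← Real.rpow_natCast,
      Real.rpow_def_of_pos hp0, Real.rpow_def_of_pos h1, ← Real.exp_add, Real.exp_le_exp]
    have h3 : Real.log p ≤ Real.log (1 - p) := Real.log_le_log hp0 (by linarith)
    have h4 : Real.log 2 * -((k + r) * binH p)
        = (k + r) * (p * Real.log p + (1 - p) * Real.log (1 - p)) := by
      unfold binH Real.logb
      field_simp
      ring
    rw [h4]
    nlinarith [mul_nonneg (sub_nonneg.2 hk) (sub_nonneg.2 h3)]

/-- Admissible state vectors. -/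
def Adm (pe pw : ℝ) {n : ℕ} (s : Fin n → Option Bool) : Prop :=
  (numErase s : ℝ) ≤ pe * n ∧ (numFlip s : ℝ) ≤ pw * n

/-- Number of positions left intact by a state vector. -/
def numKeep {n : ℕ} (s : Fin n → Option Bool) : ℕ :=
  (Finset.univ.filter fun t => s t = some false).card

lemma numErase_add_numFlip_add_numKeep {n : ℕ} (s : Fin n → Option Bool) :
    numErase s + numFlip s + numKeep s = n := by
  unfold numErase numFlip numKeep
  simp only [Finset.card_filter, ← Finset.sum_add_distrib]
  calc _ = ∑ _t : Fin n, 1 := by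
        refine Finset.sum_congr rfl fun t _ => ?_
        rcases s t with _ | _ | _ <;> simp
    _ = n := by simp

lemma prod_option_bool {n : ℕ} (s : Fin n → Option Bool) (a b c : ℝ) :
    ∏ t, (match s t with | none => a | some true => b | some false => c)
      = a ^ numErase s * b ^ numFlip s * c ^ numKeep s := by
  unfold numErase numFlip numKeep
  simp only [Finset.card_filter, ← Finset.prod_pow_eq_pow_sum, ← Finset.prod_mul_distrib]
  refine Finset.prod_congr rfl fun t _ => ?_
  rcases s t with _ | _ | _ <;> simp

/-- Volume of the set of words from which a received word can be produced. -/
lemma cnt_cefOut_eq_le (pe pw : ℝ) (hpw : 0 ≤ pw)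
    (hsum : pe + pw ≤ 1) (hhalf : pw / (1 - pe) ≤ 1 / 2) (n : ℕ) (y : Fin n → Option Bool) :
    cnt (fun x => ∃ s, Adm pe pw s ∧ cefOut x s = y)
      ≤ 2 ^ (n * (pe + (1 - pe) * binH (pw / (1 - pe)))) := by
  classical
  set p := pw / (1 - pe) with hp
  have hpe1 : 0 ≤ 1 - pe := by linarith
  have hp0 : 0 ≤ p := div_nonneg hpw hpe1
  have hpmul : p * (1 - pe) = pw := by
    rcases hpe1.eq_or_lt with h | h
    · rw [← h, mul_zero]; linarith
    · rw [hp]; field_simp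
  have hH0 := binH_nonneg hp0 (by linarith)
  have hH1 := binH_le_one p
  have hpos : ∀ r : ℝ, (0 : ℝ) < 2 ^ r := fun r => Real.rpow_pos_of_pos two_pos r
  by_cases hy : (numErase y : ℝ) ≤ pe * n
  swap
  · have : cnt (fun x => ∃ s, Adm pe pw s ∧ cefOut x s = y) = 0 := by
      rw [cnt_eq_sum]
      refine Finset.sum_eq_zero fun x _ => if_neg ?_
      rintro ⟨s, hs, rfl⟩
      apply hy
      have : numErase (cefOut x s) = numErase s := by simp [numErase, cefOut]
      rw [this]
      exact hs.1
    rw [this]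
    exact (hpos _).le
  let ω : Option Bool → Bool → ℝ := fun o b =>
    match o with
    | none => 1
    | some a => if a = b then 1 - p else p
  have hω0 : ∀ o b, 0 ≤ ω o b := by
    intro o b
    rcases o with _ | a
    · exact zero_le_one
    · simp only [ω]
      split_ifs <;> linarith
  have hsumω : ∑ x : Fin n → Bool, ∏ t, ω (y t) (x t) = 2 ^ numErase y := by
    have h2 := Finset.prod_univ_sum (fun _ : Fin n => (Finset.univ : Finset Bool))
      (fun t b => ω (y t) b)
    rw [Fintype.piFinset_univ] at h2
    rw [← h2]
    have h3 := prod_option_bool y 2 1 1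
    simp only [one_pow, mul_one] at h3
    rw [← h3]
    refine Finset.prod_congr rfl fun t _ => ?_
    rcases y t with _ | _ | _ <;> simp [ω]
  set c : ℝ := 2 ^ (-((n - numErase y) * binH p)) with hc
  have hball : ∀ x, (∃ s, Adm pe pw s ∧ cefOut x s = y) → c ≤ ∏ t, ω (y t) (x t) := by
    rintro x ⟨s, hs, rfl⟩
    have he : numErase (cefOut x s) = numErase s := by simp [numErase, cefOut]
    have h3 := prod_option_bool s 1 p (1 - p)
    have h4 : ∏ t, ω (cefOut x s t) (x t) = p ^ numFlip s * (1 - p) ^ numKeep s := by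
      rw [one_pow, one_mul] at h3
      rw [← h3]
      refine Finset.prod_congr rfl fun t _ => ?_
      unfold cefOut
      rcases s t with _ | _ | _ <;> cases x t <;> simp [ω]
    have h5 : (numErase s : ℝ) + numFlip s + numKeep s = n := by
      exact_mod_cast numErase_add_numFlip_add_numKeep s
    rw [h4, hc, he, show (n : ℝ) - numErase s = numFlip s + numKeep s by linarith]
    refine two_rpow_neg_mul_binH_le p hp0 hhalf _ _ ?_
    calc (numFlip s : ℝ) ≤ pw * n := hs.2
      _ = p * (n - pe * n) := by rw [← hpmul]; ring
      _ ≤ p * (numFlip s + numKeep s) := by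
        have := hs.1
        gcongr
        linarith
  have hcnt : cnt (fun x => ∃ s, Adm pe pw s ∧ cefOut x s = y) * c ≤ 2 ^ numErase y := by
    rw [← hsumω, cnt_eq_sum, Finset.sum_mul]
    refine Finset.sum_le_sum fun x _ => ?_
    split_ifs with hx
    · rw [one_mul]; exact hball x hx
    · rw [zero_mul]; exact Finset.prod_nonneg fun t _ => hω0 _ _
  rw [← le_div_iff₀ (hpos _), ← Real.rpow_natCast, ← Real.rpow_sub two_pos] at hcnt
  refine hcnt.trans (Real.rpow_le_rpow_of_exponent_le one_le_two ?_)
  nlinarith [mul_le_mul_of_nonneg_right hy (sub_nonneg.2 hH1)]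

/-- Two words are confusable under the state `s` when another admissible state applied to the
second word yields the same output. -/
def Confusable (pe pw : ℝ) {n : ℕ} (s : Fin n → Option Bool) (x x' : Fin n → Bool) : Prop :=
  Adm pe pw s ∧ ∃ s', Adm pe pw s' ∧ cefOut x' s' = cefOut x s

lemma cefOut_swap {n : ℕ} {x x' : Fin n → Bool} {s s' : Fin n → Option Bool}
    (h : cefOut x' s' = cefOut x s) : cefOut x s' = cefOut x' s := by
  funext t
  have ht := congrFun h t
  unfold cefOut at ht ⊢
  revert ht
  rcases s t with _ | _ | _ <;> rcases s' t with _ | _ | _ <;> cases x t <;> cases x' t <;> simp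

lemma cnt_mono {Ω : Type*} [Fintype Ω] {P Q : Ω → Prop} (h : ∀ ω, P ω → Q ω) :
    cnt P ≤ cnt Q := by
  classical
  unfold cnt
  exact_mod_cast Finset.card_le_card (Finset.monotone_filter_right _ fun ω _ => h ω)

/-- Output law of the channel under a uniform input bit. -/
noncomputable def outMarg {𝒵 : Type*} (pZ : Bool → 𝒵 → ℝ) (z : 𝒵) : ℝ :=
  ∑ x, (1 / 2 : ℝ) * pZ x z

/-- Mutual information (in bits) between a uniform input bit and the channel output. -/
noncomputable def unifInfo {𝒵 : Type*} [Fintype 𝒵] (pZ : Bool → 𝒵 → ℝ) : ℝ :=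
  ∑ xz : Bool × 𝒵, (1 / 2 : ℝ) * pZ xz.1 xz.2 * Real.logb 2 (pZ xz.1 xz.2 / outMarg pZ xz.2)

section SingleLetter

variable {𝒵 : Type*} [Fintype 𝒵] {pZ : Bool → 𝒵 → ℝ}

lemma outMarg_nonneg (hpZ : IsCondPMF pZ) (z : 𝒵) : 0 ≤ outMarg pZ z :=
  Finset.sum_nonneg fun x _ => mul_nonneg (by norm_num) ((hpZ x).1 z)

lemma outMarg_pos (hpZ : IsCondPMF pZ) {x : Bool} {z : 𝒵} (h : 0 < pZ x z) :
    0 < outMarg pZ z := by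
  refine Finset.sum_pos' (fun x _ => mul_nonneg (by norm_num) ((hpZ x).1 z))
    ⟨x, Finset.mem_univ x, by positivity⟩

lemma sum_outMarg (hpZ : IsCondPMF pZ) : ∑ z, outMarg pZ z = 1 := by
  unfold outMarg
  rw [Finset.sum_comm]
  simp [← Finset.mul_sum, (hpZ _).2]

lemma sum_half_mul (hpZ : IsCondPMF pZ) :
    ∑ xz : Bool × 𝒵, (1 / 2 : ℝ) * pZ xz.1 xz.2 = 1 := by
  rw [Fintype.sum_prod_type]
  simp [← Finset.mul_sum, (hpZ _).2]

lemma HXgZunif_eq (hpZ : IsCondPMF pZ) : HXgZunif pZ = 1 - unifInfo pZ := by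
  have h1 : ∑ z, outMarg pZ z * Real.logb 2 (outMarg pZ z)
      = ∑ xz : Bool × 𝒵, (1 / 2 : ℝ) * pZ xz.1 xz.2 * Real.logb 2 (outMarg pZ xz.2) := by
    rw [Fintype.sum_prod_type_right]
    refine Finset.sum_congr rfl fun z _ => ?_
    simp only [← Finset.sum_mul]
    rfl
  have h2 : HXgZunif pZ = -∑ xz : Bool × 𝒵, ((1 / 2 : ℝ) * pZ xz.1 xz.2)
      * Real.logb 2 ((1 / 2 : ℝ) * pZ xz.1 xz.2)
      - -∑ z, outMarg pZ z * Real.logb 2 (outMarg pZ z) := rfl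
  rw [h2, h1, show 1 - unifInfo pZ
    = ∑ xz : Bool × 𝒵, (1 / 2 : ℝ) * pZ xz.1 xz.2 - unifInfo pZ by rw [sum_half_mul hpZ]]
  unfold unifInfo
  rw [← Finset.sum_neg_distrib, ← Finset.sum_neg_distrib, ← Finset.sum_sub_distrib,
    ← Finset.sum_sub_distrib]
  refine Finset.sum_congr rfl fun xz _ => ?_
  rcases ((hpZ xz.1).1 xz.2).eq_or_lt with h | h
  · simp [← h]
  · have hq := outMarg_pos hpZ h
    rw [Real.logb_mul (by norm_num) h.ne', Real.logb_div h.ne' hq.ne', one_div,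
      Real.logb_inv, Real.logb_self_eq_one one_lt_two]
    ring

lemma unifInfo_nonneg (hpZ : IsCondPMF pZ) : 0 ≤ unifInfo pZ := by
  have hl : 0 < Real.log 2 := Real.log_pos one_lt_two
  have h : ∑ xz : Bool × 𝒵, ((1 / 2 : ℝ) * pZ xz.1 xz.2 - 1 / 2 * outMarg pZ xz.2) / Real.log 2
      ≤ unifInfo pZ := by
    refine Finset.sum_le_sum fun xz _ => ?_
    rcases ((hpZ xz.1).1 xz.2).eq_or_lt with h | h
    · rw [← h]
      have := outMarg_nonneg hpZ xz.2
      simp only [mul_zero, zero_mul]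
      exact div_nonpos_of_nonpos_of_nonneg (by linarith) hl.le
    · have hq := outMarg_pos hpZ h
      have h3 := Real.one_sub_inv_le_log_of_pos (div_pos h hq)
      rw [inv_div] at h3
      unfold Real.logb
      rw [← mul_div_assoc]
      gcongr
      calc _ = 1 / 2 * pZ xz.1 xz.2 * (1 - outMarg pZ xz.2 / pZ xz.1 xz.2) := by field_simp
        _ ≤ _ := by gcongr
  refine le_trans (le_of_eq ?_) h
  rw [← Finset.sum_div, Finset.sum_sub_distrib, sum_half_mul hpZ, Fintype.sum_prod_type]
  simp [← Finset.mul_sum, sum_outMarg hpZ]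

end SingleLetter

lemma isCondPMF_becChan {q : ℝ} (h0 : 0 ≤ q) (h1 : q ≤ 1) : IsCondPMF (becChan q) := by
  intro x
  constructor
  · intro z
    rcases z with _ | z
    · exact h0
    · simp only [becChan, Option.elim]
      split_ifs <;> linarith
  · cases x <;> simp [becChan, Fintype.sum_option]

lemma HXgZunif_becChan {q : ℝ} (h0 : 0 ≤ q) (h1 : q ≤ 1) : HXgZunif (becChan q) = q := by
  rw [HXgZunif_eq (isCondPMF_becChan h0 h1)]
  have : unifInfo (becChan q) = 1 - q := by
    unfold unifInfo outMarg
    simp only [Fintype.sum_prod_type, Fintype.sum_option, Fintype.sum_bool, becChan, Option.elim]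
    have e : (1 / 2 : ℝ) * q + 1 / 2 * q = q := by ring
    rcases h1.eq_or_lt with rfl | h1
    · norm_num
    · have hq : (1 - q) / (1 / 2 * (1 - q)) = 2 := by
        have : 1 - q ≠ 0 := by linarith
        field_simp
      rcases h0.eq_or_lt with rfl | h0
      · norm_num [hq]
      · rw [e, div_self h0.ne', Real.logb_one]
        norm_num [hq]
        ring
  rw [this]; ring

/-- A random variable with negative mean has an exponential moment below one. -/
lemma exists_sum_mul_exp_lt_one {Ω : Type*} [Fintype Ω] (P y : Ω → ℝ) (hP : ∀ ω, 0 ≤ P ω)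
    (hP1 : ∑ ω, P ω = 1) (hy : ∑ ω, P ω * y ω < 0) :
    ∃ l > 0, ∑ ω, P ω * Real.exp (l * y ω) < 1 := by
  set m := ∑ ω, P ω * y ω with hm
  set B := 1 + ∑ ω, |y ω| with hB
  have hyB : ∀ ω, |y ω| ≤ B := fun ω => by
    have := Finset.single_le_sum (fun ω _ => abs_nonneg (y ω)) (Finset.mem_univ ω)
    linarith
  have hB1 : 1 ≤ B := by
    have := Finset.sum_nonneg (fun ω (_ : ω ∈ Finset.univ) => abs_nonneg (y ω))
    linarith
  have hBpos : 0 < B := by linarith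
  set l := min (1 / B) (-m / (2 * B ^ 2)) with hl
  have hl0 : 0 < l := lt_min (by positivity) (div_pos (by linarith) (by positivity))
  have hl1 : l * B ≤ 1 := (le_div_iff₀ hBpos).1 (min_le_left _ _)
  have hl2 : l * (2 * B ^ 2) ≤ -m := (le_div_iff₀ (by positivity)).1 (min_le_right _ _)
  refine ⟨l, hl0, ?_⟩
  calc ∑ ω, P ω * Real.exp (l * y ω)
      ≤ ∑ ω, (P ω + l * (P ω * y ω) + P ω * (l ^ 2 * B ^ 2)) := by
        refine Finset.sum_le_sum fun ω _ => ?_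
        have ha : |l * y ω| ≤ l * B := by
          rw [abs_mul, abs_of_pos hl0]
          exact mul_le_mul_of_nonneg_left (hyB ω) hl0.le
        have h1 := (abs_le.1 (Real.abs_exp_sub_one_sub_id_le (ha.trans hl1))).2
        have h2 : (l * y ω) ^ 2 ≤ (l * B) ^ 2 := sq_le_sq' (by linarith [(abs_le.1 ha).1])
          (abs_le.1 ha).2
        have h3 : Real.exp (l * y ω) ≤ 1 + l * y ω + l ^ 2 * B ^ 2 := by nlinarith
        calc _ ≤ P ω * (1 + l * y ω + l ^ 2 * B ^ 2) := mul_le_mul_of_nonneg_left h3 (hP ω)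
          _ = _ := by ring
    _ = 1 + l * m + l ^ 2 * B ^ 2 := by
        rw [Finset.sum_add_distrib, Finset.sum_add_distrib, ← Finset.mul_sum, ← Finset.sum_mul,
          hP1, one_mul]
    _ < 1 := by nlinarith

section Memoryless

variable {𝒵 : Type*} [Fintype 𝒵] {pZ : Bool → 𝒵 → ℝ}

lemma chanZn_nonneg (hpZ : IsCondPMF pZ) {n : ℕ} (x : Fin n → Bool) (z : Fin n → 𝒵) :
    0 ≤ chanZn pZ x z :=
  Finset.prod_nonneg fun t _ => (hpZ (x t)).1 (z t)

lemma sum_prod_apply {n : ℕ} {α : Type*} [Fintype α] (g : Fin n → α → ℝ) :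
    ∑ x : Fin n → α, ∏ t, g t (x t) = ∏ t, ∑ a, g t a := by
  classical
  rw [Finset.prod_univ_sum, Fintype.piFinset_univ]

lemma sum_chanZn (hpZ : IsCondPMF pZ) {n : ℕ} (x : Fin n → Bool) :
    ∑ z, chanZn pZ x z = 1 := by
  unfold chanZn
  rw [sum_prod_apply fun t b => pZ (x t) b]
  simp [(hpZ _).2]

/-- Output law of the memoryless channel under a uniform input word. -/
noncomputable def outMargN (pZ : Bool → 𝒵 → ℝ) {n : ℕ} (z : Fin n → 𝒵) : ℝ :=
  ∏ t, outMarg pZ (z t)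

lemma outMargN_nonneg (hpZ : IsCondPMF pZ) {n : ℕ} (z : Fin n → 𝒵) : 0 ≤ outMargN pZ z :=
  Finset.prod_nonneg fun t _ => outMarg_nonneg hpZ (z t)

lemma sum_outMargN (hpZ : IsCondPMF pZ) (n : ℕ) : ∑ z : Fin n → 𝒵, outMargN pZ z = 1 := by
  unfold outMargN
  rw [sum_prod_apply fun _ b => outMarg pZ b]
  simp [sum_outMarg hpZ]

lemma sum_chanZn_input {n : ℕ} (z : Fin n → 𝒵) :
    ∑ x, chanZn pZ x z = 2 ^ n * outMargN pZ z := by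
  unfold chanZn outMargN
  rw [sum_prod_apply fun t a => pZ a (z t)]
  have : ∀ t, ∑ a, pZ a (z t) = 2 * outMarg pZ (z t) := fun t => by
    unfold outMarg; rw [← Finset.mul_sum]; ring
  simp only [this, Finset.prod_mul_distrib]
  simp

lemma chanZn_le (hpZ : IsCondPMF pZ) {n : ℕ} (x : Fin n → Bool) (z : Fin n → 𝒵) :
    chanZn pZ x z ≤ 2 ^ n * outMargN pZ z := by
  rw [← sum_chanZn_input]
  exact Finset.single_le_sum (fun x _ => chanZn_nonneg hpZ x z) (Finset.mem_univ x)

open Classical in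
/-- Probability, given the input word, of an atypically informative output word. -/
noncomputable def atypMass (pZ : Bool → 𝒵 → ℝ) {n : ℕ} (M : ℝ) (x : Fin n → Bool)
    (z : Fin n → 𝒵) : ℝ :=
  if M * outMargN pZ z < chanZn pZ x z then chanZn pZ x z else 0

lemma atypMass_nonneg (hpZ : IsCondPMF pZ) {n : ℕ} (M : ℝ) (x : Fin n → Bool)
    (z : Fin n → 𝒵) : 0 ≤ atypMass pZ M x z := by
  unfold atypMass
  split_ifs
  exacts [chanZn_nonneg hpZ x z, le_rfl]

/-- The information density concentrates: outputs whose likelihood ratio exceeds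
`2 ^ (n (I + δ))` have exponentially small probability. -/
lemma exists_sum_atypMass_le (hpZ : IsCondPMF pZ) {δ : ℝ} (hδ : 0 < δ) :
    ∃ ρ : ℝ, 0 ≤ ρ ∧ ρ < 1 ∧ ∀ n : ℕ, ∑ x : Fin n → Bool, ∑ z : Fin n → 𝒵,
      atypMass pZ (2 ^ (n * (unifInfo pZ + δ))) x z ≤ ρ ^ n * 2 ^ n := by
  have hlog : 0 < Real.log 2 := Real.log_pos one_lt_two
  let P : Bool × 𝒵 → ℝ := fun xz => 1 / 2 * pZ xz.1 xz.2
  let y : Bool × 𝒵 → ℝ := fun xz =>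
    Real.log (pZ xz.1 xz.2 / outMarg pZ xz.2) - (unifInfo pZ + δ) * Real.log 2
  have hP : ∀ xz, 0 ≤ P xz := fun xz => mul_nonneg (by norm_num) ((hpZ _).1 _)
  have hP1 : ∑ xz, P xz = 1 := sum_half_mul hpZ
  have hy : ∑ xz, P xz * y xz = -(δ * Real.log 2) := by
    simp only [y, mul_sub, Finset.sum_sub_distrib, ← Finset.sum_mul, hP1]
    have : ∑ xz, P xz * Real.log (pZ xz.1 xz.2 / outMarg pZ xz.2)
        = unifInfo pZ * Real.log 2 := by
      unfold unifInfo Real.logb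
      rw [Finset.sum_mul]
      refine Finset.sum_congr rfl fun xz _ => ?_
      simp only [P]
      field_simp
    rw [this]; ring
  obtain ⟨l, hl, hlt⟩ := exists_sum_mul_exp_lt_one P y hP hP1 (by
    rw [hy]; exact neg_neg_of_pos (by positivity))
  refine ⟨_, Finset.sum_nonneg fun xz _ => mul_nonneg (hP xz) (Real.exp_pos _).le, hlt, ?_⟩
  intro n
  have hpt : ∀ (x : Fin n → Bool) (z : Fin n → 𝒵),
      atypMass pZ (2 ^ (n * (unifInfo pZ + δ))) x z
        ≤ ∏ t, (pZ (x t) (z t) * Real.exp (l * y (x t, z t))) := by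
    intro x z
    have hnn : 0 ≤ ∏ t, (pZ (x t) (z t) * Real.exp (l * y (x t, z t))) :=
      Finset.prod_nonneg fun t _ => mul_nonneg ((hpZ _).1 _) (Real.exp_pos _).le
    unfold atypMass
    split_ifs with h
    swap
    · exact hnn
    have hMpos : (0 : ℝ) < 2 ^ (n * (unifInfo pZ + δ)) := Real.rpow_pos_of_pos two_pos _
    have hW : 0 < chanZn pZ x z :=
      lt_of_le_of_lt (mul_nonneg hMpos.le (outMargN_nonneg hpZ z)) h
    have hWt : ∀ t, 0 < pZ (x t) (z t) := fun t =>
      lt_of_le_of_ne ((hpZ _).1 _) fun h0 =>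
        hW.ne' (Finset.prod_eq_zero (Finset.mem_univ t) h0.symm)
    have hQt : ∀ t, 0 < outMarg pZ (z t) := fun t => outMarg_pos hpZ (hWt t)
    have hQ : 0 < outMargN pZ z := Finset.prod_pos fun t _ => hQt t
    rw [Finset.prod_mul_distrib, ← Real.exp_sum, ← Finset.mul_sum]
    refine le_mul_of_one_le_right hW.le (Real.one_le_exp (mul_nonneg hl.le ?_))
    simp only [y]
    rw [Finset.sum_sub_distrib, ← Real.log_prod (fun t _ => (div_pos (hWt t) (hQt t)).ne'),
      Finset.prod_div_distrib]
    simp only [Finset.sum_const, Finset.card_univ, Fintype.card_fin, nsmul_eq_mul]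
    have h2 := Real.log_le_log hMpos ((lt_div_iff₀ hQ).2 h).le
    rw [Real.log_rpow two_pos] at h2
    unfold chanZn outMargN at h2
    linarith
  calc _ ≤ ∑ x : Fin n → Bool, ∑ z : Fin n → 𝒵,
        ∏ t, (pZ (x t) (z t) * Real.exp (l * y (x t, z t))) :=
        Finset.sum_le_sum fun x _ => Finset.sum_le_sum fun z _ => hpt x z
    _ = ∑ x : Fin n → Bool, ∏ t, ∑ b, (pZ (x t) b * Real.exp (l * y (x t, b))) := by
        refine Finset.sum_congr rfl fun x _ => ?_
        rw [sum_prod_apply fun t b => pZ (x t) b * Real.exp (l * y (x t, b))]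
    _ = (∑ a, ∑ b, (pZ a b * Real.exp (l * y (a, b)))) ^ n := by
        rw [sum_prod_apply fun _ a => ∑ b, (pZ a b * Real.exp (l * y (a, b)))]
        simp
    _ = _ := by
        rw [← mul_pow, Finset.sum_mul, Fintype.sum_prod_type]
        congr 1
        refine Finset.sum_congr rfl fun a _ => Finset.sum_congr rfl fun b _ => ?_
        simp only [P]
        ring

end Memoryless

/-- If every conditional output law is dominated by `4 Q + A` and by `2 ^ n Q`, then the leaked
information is at most a constant plus `2 n` times the average mass of `A`. -/
lemma miBits_le {Z : Type*} [Fintype Z] (n K : ℕ) (hK : 0 < K) (P A : Fin K → Z → ℝ) (Q : Z → ℝ)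
    (P0 : ∀ u z, 0 ≤ P u z) (P1 : ∀ u, ∑ z, P u z = 1) (Q1 : ∑ z, Q z = 1)
    (A0 : ∀ u z, 0 ≤ A u z) (hA : ∀ u z, P u z ≤ 4 * Q z + A u z)
    (hQ : ∀ u z, P u z ≤ 2 ^ n * Q z) :
    miBits (fun u z => 1 / (K : ℝ) * P u z) ≤ 3 + 2 * n * (1 / (K : ℝ) * ∑ u, ∑ z, A u z) := by
  have hK0 : (0 : ℝ) < K := by exact_mod_cast hK
  have hl : 0 < Real.log 2 := Real.log_pos one_lt_two
  have Q0 : ∀ z, 0 ≤ Q z := fun z => by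
    have := (P0 ⟨0, hK⟩ z).trans (hQ ⟨0, hK⟩ z)
    exact nonneg_of_mul_nonneg_right this (by positivity)
  set Pb : Z → ℝ := fun z => ∑ u, 1 / (K : ℝ) * P u z with hPb
  have Pb0 : ∀ z, 0 ≤ Pb z := fun z => Finset.sum_nonneg fun u _ =>
    mul_nonneg (by positivity) (P0 u z)
  have Pb1 : ∑ z, Pb z = 1 := by
    simp only [hPb]
    rw [Finset.sum_comm]
    simp only [← Finset.mul_sum, P1]
    simp [hK0.ne']
  have hmarg : ∀ u, ∑ z, 1 / (K : ℝ) * P u z = 1 / K := fun u => by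
    rw [← Finset.mul_sum, P1, mul_one]
  have hpt : ∀ u z, 1 / (K : ℝ) * P u z * Real.logb 2
      (1 / (K : ℝ) * P u z / ((∑ z', 1 / (K : ℝ) * P u z') * Pb z))
      ≤ 3 * (1 / K * P u z) + 2 * n * (1 / K * A u z)
        + 1 / K * P u z * (Q z / Pb z - 1) / Real.log 2 := by
    intro u z
    rw [hmarg u]
    rcases (P0 u z).eq_or_lt with h | h
    · rw [← h]
      have := A0 u z
      simp only [mul_zero, zero_mul, zero_add, zero_div, add_zero]
      positivity
    have hQz : 0 < Q z := by
      rcases (Q0 z).eq_or_lt with h' | h'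
      · have := hQ u z
        rw [← h', mul_zero] at this
        linarith
      · exact h'
    have hPbz : 0 < Pb z := Finset.sum_pos' (fun u _ => mul_nonneg (by positivity) (P0 u z))
      ⟨u, Finset.mem_univ u, by positivity⟩
    have e1 : 1 / (K : ℝ) * P u z / (1 / K * Pb z) = (P u z / Q z) * (Q z / Pb z) := by
      field_simp
    rw [e1, Real.logb_mul (by positivity) (by positivity), mul_add]
    have e2 : Real.logb 2 (Q z / Pb z) ≤ (Q z / Pb z - 1) / Real.log 2 := by
      unfold Real.logb
      gcongr
      exact Real.log_le_sub_one_of_pos (by positivity)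
    have e3 : 1 / (K : ℝ) * P u z * Real.logb 2 (Q z / Pb z)
        ≤ 1 / K * P u z * (Q z / Pb z - 1) / Real.log 2 := by
      rw [mul_div_assoc]
      gcongr
    have e4 : P u z * Real.logb 2 (P u z / Q z) ≤ 3 * P u z + 2 * n * A u z := by
      rcases le_or_gt (A u z) (4 * Q z) with hc | hc
      · have h8 : P u z / Q z ≤ 2 ^ (3 : ℝ) := by
          rw [div_le_iff₀ hQz]
          have := hA u z
          norm_num
          linarith
        have h9 : Real.logb 2 (P u z / Q z) ≤ 3 :=
          (Real.logb_le_iff_le_rpow one_lt_two (by positivity)).2 h8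
        have := mul_le_mul_of_nonneg_left h9 h.le
        have h10 : 0 ≤ 2 * n * A u z := mul_nonneg (by positivity) (A0 u z)
        linarith
      · have h8 : P u z / Q z ≤ 2 ^ (n : ℝ) := by
          rw [div_le_iff₀ hQz, Real.rpow_natCast]
          exact hQ u z
        have h9 : Real.logb 2 (P u z / Q z) ≤ n :=
          (Real.logb_le_iff_le_rpow one_lt_two (by positivity)).2 h8
        have h10 : P u z ≤ 2 * A u z := by
          have := hA u z
          linarith
        calc _ ≤ P u z * n := mul_le_mul_of_nonneg_left h9 h.le
          _ ≤ 2 * A u z * n := by gcongr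
          _ ≤ _ := by linarith
    have e5 := mul_le_mul_of_nonneg_left e4 (show 0 ≤ 1 / (K : ℝ) by positivity)
    have e6 : 1 / (K : ℝ) * (P u z * Real.logb 2 (P u z / Q z))
        = 1 / K * P u z * Real.logb 2 (P u z / Q z) := by ring
    have e7 : 1 / (K : ℝ) * (3 * P u z + 2 * n * A u z)
      = 3 * (1 / K * P u z) + 2 * n * (1 / K * A u z) := by ring
    linarith
  have hgibbs : ∑ u, ∑ z, 1 / (K : ℝ) * P u z * (Q z / Pb z - 1) / Real.log 2 ≤ 0 := by
    rw [Finset.sum_comm]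
    have : ∀ z, ∑ u, 1 / (K : ℝ) * P u z * (Q z / Pb z - 1) / Real.log 2
        ≤ (Q z - Pb z) / Real.log 2 := by
      intro z
      rw [← Finset.sum_div, ← Finset.sum_mul]
      change Pb z * _ / _ ≤ _
      gcongr
      rcases (Pb0 z).eq_or_lt with h | h
      · rw [← h]; simpa using Q0 z
      · exact le_of_eq (by field_simp)
    refine (Finset.sum_le_sum fun z _ => this z).trans ?_
    rw [← Finset.sum_div, Finset.sum_sub_distrib, Q1, Pb1]
    simp
  unfold miBits
  calc _ ≤ ∑ u, ∑ z, (3 * (1 / K * P u z) + 2 * n * (1 / K * A u z)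
        + 1 / K * P u z * (Q z / Pb z - 1) / Real.log 2) :=
        Finset.sum_le_sum fun u _ => Finset.sum_le_sum fun z _ => hpt u z
    _ = 3 + 2 * n * (1 / (K : ℝ) * ∑ u, ∑ z, A u z)
        + ∑ u, ∑ z, 1 / (K : ℝ) * P u z * (Q z / Pb z - 1) / Real.log 2 := by
        simp only [Finset.sum_add_distrib, ← Finset.mul_sum, P1]
        simp [hK0.ne']
    _ ≤ _ := by linarith

/-- A constant encoder sending a single message. -/
def trivialEnc (n : ℕ) : StochEnc n 1 where
  E := fun _ x => if x = fun _ => false then 1 else 0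
  nonneg := fun _ x => by split_ifs <;> norm_num
  sum_one := fun _ => by simp

lemma securelyAchievableCEF_of_nonpos {𝒵 : Type*} [Fintype 𝒵] {pZ : Bool → 𝒵 → ℝ}
    (hpZ : IsCondPMF pZ) (pe pw : ℝ) {R : ℝ} (hR : R ≤ 0) :
    SecurelyAchievableCEF pZ pe pw R := by
  intro ε hε
  refine ⟨1, 1, trivialEnc 1, fun _ => 0, one_pos, one_pos, ?_, fun Jm => ?_, ?_⟩
  · simp only [Nat.cast_one, mul_one]
    exact Real.rpow_le_one_of_one_le_of_nonpos one_le_two hR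
  · unfold avgErrCEF
    simp [Fin.isValue, Subsingleton.elim _ (0 : Fin 1)]
    exact hε.le
  · have h : miBits (jointUZ pZ (trivialEnc 1)) = 0 := by
      unfold miBits jointUZ
      have hs : ∑ z : Fin 1 → 𝒵, chanZn pZ (fun _ => false) z = 1 := sum_chanZn hpZ _
      simp [trivialEnc, hs]
      refine Finset.sum_eq_zero fun z _ => ?_
      by_cases h0 : chanZn pZ (fun _ => false) z = 0
      · simp [h0]
      · simp [div_self h0]
    rw [h]
    simpa using hε.le

section Coding

variable {𝒵 : Type*} [Fintype 𝒵] {pZ : Bool → 𝒵 → ℝ} {n K L : ℕ}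

/-- The stochastic encoder that picks uniformly one of the `L` codewords of a message. -/
noncomputable def codeEnc (hL : 0 < L) (c : Fin (K * L) → Fin n → Bool) : StochEnc n K where
  E := fun u x => 1 / (L : ℝ) * ∑ w : Fin L, if c (finProdFinEquiv (u, w)) = x then 1 else 0
  nonneg := fun u x => mul_nonneg (by positivity)
    (Finset.sum_nonneg fun w _ => by split_ifs <;> norm_num)
  sum_one := fun u => by
    have hL0 : (L : ℝ) ≠ 0 := by exact_mod_cast hL.ne'
    rw [← Finset.mul_sum, Finset.sum_comm]
    simp [hL0]

lemma sum_codeEnc_mul (hL : 0 < L) (c : Fin (K * L) → Fin n → Bool) (u : Fin K)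
    (F : (Fin n → Bool) → ℝ) :
    ∑ x, (codeEnc hL c).E u x * F x
      = 1 / (L : ℝ) * ∑ w : Fin L, F (c (finProdFinEquiv (u, w))) := by
  simp only [codeEnc, mul_assoc, ← Finset.mul_sum, Finset.sum_mul]
  rw [Finset.sum_comm]
  simp

lemma average_blocks (F : Fin (K * L) → ℝ) :
    1 / (K : ℝ) * ∑ u : Fin K, 1 / (L : ℝ) * ∑ w : Fin L, F (finProdFinEquiv (u, w))
      = 1 / ((K : ℝ) * L) * ∑ i, F i := by
  rw [← finProdFinEquiv.sum_comp, Fintype.sum_prod_type, ← Finset.mul_sum]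
  rw [← mul_assoc]
  congr 1
  rw [one_div_mul_one_div]

open Classical in
/-- Decoder returning the message of the first codeword compatible with the received word. -/
noncomputable def firstDec (pe pw : ℝ) (hK : 0 < K) (c : Fin (K * L) → Fin n → Bool)
    (y : Fin n → Option Bool) : Fin K :=
  if h : (Finset.univ.filter fun i => ∃ s, Adm pe pw s ∧ cefOut (c i) s = y).Nonempty then
    (finProdFinEquiv.symm
      ((Finset.univ.filter fun i => ∃ s, Adm pe pw s ∧ cefOut (c i) s = y).min' h)).1
  else ⟨0, hK⟩

lemma exists_lt_confusable_of_firstDec_ne {pe pw : ℝ} (hK : 0 < K)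
    (c : Fin (K * L) → Fin n → Bool) (i : Fin (K * L)) {s : Fin n → Option Bool}
    (hs : Adm pe pw s)
    (h : firstDec pe pw hK c (cefOut (c i) s) ≠ (finProdFinEquiv.symm i).1) :
    ∃ j, j < i ∧ Confusable pe pw s (c i) (c j) := by
  classical
  have hi : i ∈ Finset.univ.filter fun k => ∃ s', Adm pe pw s' ∧ cefOut (c k) s'
      = cefOut (c i) s := by
    simp only [Finset.mem_filter, Finset.mem_univ, true_and]
    exact ⟨s, hs, rfl⟩
  have hne : (Finset.univ.filter fun k => ∃ s', Adm pe pw s' ∧ cefOut (c k) s'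
      = cefOut (c i) s).Nonempty := ⟨i, hi⟩
  unfold firstDec at h
  rw [dif_pos hne] at h
  refine ⟨_, lt_of_le_of_ne (Finset.min'_le _ _ hi) fun he => h (by rw [he]), hs, ?_⟩
  have := Finset.min'_mem _ hne
  simp only [Finset.mem_filter, Finset.mem_univ, true_and] at this
  exact this

open Classical in
/-- Likelihood ratio of the channel, truncated to typical outputs. -/
noncomputable def typRatio (pZ : Bool → 𝒵 → ℝ) (M : ℝ) (z : Fin n → 𝒵) (x : Fin n → Bool) : ℝ :=
  if M * outMargN pZ z < chanZn pZ x z then 0 else chanZn pZ x z / outMargN pZ z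

lemma typRatio_nonneg (hpZ : IsCondPMF pZ) (M : ℝ) (z : Fin n → 𝒵) (x : Fin n → Bool) :
    0 ≤ typRatio pZ M z x := by
  unfold typRatio
  split_ifs
  exacts [le_rfl, div_nonneg (chanZn_nonneg hpZ x z) (outMargN_nonneg hpZ z)]

lemma typRatio_le (hpZ : IsCondPMF pZ) {M : ℝ} (hM : 0 ≤ M) (z : Fin n → 𝒵) (x : Fin n → Bool) :
    typRatio pZ M z x ≤ M := by
  unfold typRatio
  split_ifs with h
  · exact hM
  · exact div_le_of_le_mul₀ (outMargN_nonneg hpZ z) hM (not_lt.1 h)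

lemma sum_typRatio_le (hpZ : IsCondPMF pZ) (M : ℝ) (z : Fin n → 𝒵) :
    ∑ x, typRatio pZ M z x ≤ 2 ^ n := by
  calc _ ≤ ∑ x, chanZn pZ x z / outMargN pZ z := by
        refine Finset.sum_le_sum fun x _ => ?_
        unfold typRatio
        split_ifs
        exacts [div_nonneg (chanZn_nonneg hpZ x z) (outMargN_nonneg hpZ z), le_rfl]
    _ = 2 ^ n * outMargN pZ z / outMargN pZ z := by rw [← Finset.sum_div, sum_chanZn_input]
    _ ≤ _ := by
        rcases (outMargN_nonneg hpZ z).eq_or_lt with h | h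
        · rw [← h]; simp
        · rw [mul_div_cancel_right₀ _ h.ne']

lemma chanZn_eq_typRatio_add (hpZ : IsCondPMF pZ) (M : ℝ) (z : Fin n → 𝒵) (x : Fin n → Bool) :
    chanZn pZ x z = outMargN pZ z * typRatio pZ M z x + atypMass pZ M x z := by
  unfold typRatio atypMass
  split_ifs
  · simp
  · rcases (outMargN_nonneg hpZ z).eq_or_lt with h | h
    · have := chanZn_le hpZ x z
      rw [← h, mul_zero] at this
      rw [← h]
      simpa using le_antisymm this (chanZn_nonneg hpZ x z)
    · field_simp
      simp

open Classical in
/-- Reliability of a codebook with few confusable codewords. -/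
lemma avgErrCEF_le (hpZ : IsCondPMF pZ) {pe pw : ℝ} {M η α : ℝ} (hK : 0 < K) (hL : 0 < L)
    (c : Fin (K * L) → Fin n → Bool)
    (hc1 : ∑ i, ∑ z, atypMass pZ M (c i) z ≤ 4 * α * (K * L))
    (hc3 : ∀ (z : Fin n → 𝒵) (s : Fin n → Option Bool),
      ∑ i, (if ∃ j, j < i ∧ Confusable pe pw s (c i) (c j) then typRatio pZ M z (c i) else 0)
        ≤ 3 * η * (K * L)) (Jm : JammerCEF 𝒵 pe pw n) :
    avgErrCEF pZ (codeEnc hL c) (firstDec pe pw hK c) Jm.J ≤ 3 * η + 4 * α := by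
  have hN : (0 : ℝ) < (K : ℝ) * L := by positivity
  unfold avgErrCEF
  set F : Fin (K * L) → ℝ := fun i => ∑ z, ∑ s, chanZn pZ (c i) z * Jm.J z s *
    (if firstDec pe pw hK c (cefOut (c i) s) = (finProdFinEquiv.symm i).1 then 0 else 1) with hF
  have e : ∀ u, ∑ x, (codeEnc hL c).E u x * ∑ z, ∑ s, chanZn pZ x z * Jm.J z s *
      (if firstDec pe pw hK c (cefOut x s) = u then 0 else 1)
      = 1 / (L : ℝ) * ∑ w : Fin L, F (finProdFinEquiv (u, w)) := fun u => by
    rw [sum_codeEnc_mul hL c u fun x => ∑ z, ∑ s, chanZn pZ x z * Jm.J z s *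
      (if firstDec pe pw hK c (cefOut x s) = u then 0 else 1)]
    simp only [hF, Equiv.symm_apply_apply]
  rw [Finset.sum_congr rfl fun u _ => e u, average_blocks, one_div_mul_eq_div, div_le_iff₀ hN]
  calc _ ≤ ∑ i, ∑ z, ∑ s, Jm.J z s * (outMargN pZ z *
        (if ∃ j, j < i ∧ Confusable pe pw s (c i) (c j) then typRatio pZ M z (c i) else 0)
          + atypMass pZ M (c i) z) := by
        refine Finset.sum_le_sum fun i _ => Finset.sum_le_sum fun z _ =>
          Finset.sum_le_sum fun s _ => ?_
        have hJ := Jm.nonneg z s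
        have hA := atypMass_nonneg hpZ M (c i) z
        have hf := typRatio_nonneg hpZ M z (c i)
        have hQ := outMargN_nonneg hpZ z
        have hR : 0 ≤ Jm.J z s * (outMargN pZ z *
            (if ∃ j, j < i ∧ Confusable pe pw s (c i) (c j) then typRatio pZ M z (c i) else 0)
              + atypMass pZ M (c i) z) := by
          split_ifs <;> positivity
        split_ifs at hR ⊢ with h1 h2 h2
        · simpa using hR
        · simpa using hR
        · rw [mul_one, mul_comm, ← chanZn_eq_typRatio_add hpZ]
        · rcases hJ.eq_or_lt with h | h
          · simp [← h]
          · exact absurd (exists_lt_confusable_of_firstDec_ne hK c i (Jm.supp z s h.ne') h1) h2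
    _ = ∑ z, ∑ s, Jm.J z s * outMargN pZ z * (∑ i,
        (if ∃ j, j < i ∧ Confusable pe pw s (c i) (c j) then typRatio pZ M z (c i) else 0))
          + ∑ i, ∑ z, atypMass pZ M (c i) z := by
        simp only [mul_add, Finset.sum_add_distrib]
        congr 1
        · rw [Finset.sum_comm]
          refine Finset.sum_congr rfl fun z _ => ?_
          rw [Finset.sum_comm]
          refine Finset.sum_congr rfl fun s _ => ?_
          rw [Finset.mul_sum]
          exact Finset.sum_congr rfl fun i _ => by ring
        · refine Finset.sum_congr rfl fun i _ => Finset.sum_congr rfl fun z _ => ?_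
          rw [← Finset.sum_mul, Jm.sum_one, one_mul]
    _ ≤ ∑ z, ∑ s, Jm.J z s * outMargN pZ z * (3 * η * (K * L)) + 4 * α * (K * L) := by
        refine add_le_add (Finset.sum_le_sum fun z _ => Finset.sum_le_sum fun s _ => ?_) hc1
        exact mul_le_mul_of_nonneg_left (hc3 z s)
          (mul_nonneg (Jm.nonneg z s) (outMargN_nonneg hpZ z))
    _ = _ := by
        simp only [← Finset.sum_mul, Jm.sum_one, one_mul, sum_outMargN hpZ]
        ring

/-- Secrecy of a codebook whose messages spread evenly over the channel outputs. -/
lemma miBits_jointUZ_le (hpZ : IsCondPMF pZ) {M α : ℝ} (hK : 0 < K) (hL : 0 < L)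
    (c : Fin (K * L) → Fin n → Bool)
    (hc1 : ∑ i, ∑ z, atypMass pZ M (c i) z ≤ 4 * α * (K * L))
    (hc2 : ∀ (z : Fin n → 𝒵) (u : Fin K),
      ∑ w : Fin L, typRatio pZ M z (c (finProdFinEquiv (u, w))) ≤ 4 * L) :
    miBits (jointUZ pZ (codeEnc hL c)) ≤ 3 + 2 * n * (4 * α) := by
  have hL0 : (0 : ℝ) < L := by exact_mod_cast hL
  have hN : (0 : ℝ) < (K : ℝ) * L := by positivity
  have e : jointUZ pZ (codeEnc hL c) = fun u z => 1 / (K : ℝ) *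
      (1 / (L : ℝ) * ∑ w : Fin L, chanZn pZ (c (finProdFinEquiv (u, w))) z) := by
    funext u z
    unfold jointUZ
    rw [sum_codeEnc_mul hL c u fun x => chanZn pZ x z]
  rw [e]
  refine (miBits_le n K hK _ (fun u z => 1 / (L : ℝ) *
    ∑ w : Fin L, atypMass pZ M (c (finProdFinEquiv (u, w))) z) (outMargN pZ) ?_ ?_
    (sum_outMargN hpZ n) ?_ ?_ ?_).trans ?_
  · exact fun u z => mul_nonneg (by positivity) (Finset.sum_nonneg fun w _ => chanZn_nonneg hpZ _ _)
  · intro u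
    rw [← Finset.mul_sum, Finset.sum_comm]
    simp only [sum_chanZn hpZ]
    simp [hL0.ne']
  · exact fun u z => mul_nonneg (by positivity)
      (Finset.sum_nonneg fun w _ => atypMass_nonneg hpZ _ _ _)
  · intro u z
    simp only [chanZn_eq_typRatio_add hpZ M z]
    rw [Finset.sum_add_distrib, mul_add, ← Finset.mul_sum]
    refine add_le_add ?_ le_rfl
    calc _ ≤ 1 / (L : ℝ) * (outMargN pZ z * (4 * L)) := by
          have := outMargN_nonneg hpZ z
          gcongr
          exact hc2 z u
      _ = _ := by field_simp
  · intro u z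
    calc _ ≤ 1 / (L : ℝ) * ∑ w : Fin L, 2 ^ n * outMargN pZ z := by
          gcongr
          exact chanZn_le hpZ _ _
      _ = _ := by simp; field_simp
  · have h2 : 1 / (K : ℝ) * ∑ u : Fin K, ∑ z, 1 / (L : ℝ) *
        ∑ w : Fin L, atypMass pZ M (c (finProdFinEquiv (u, w))) z ≤ 4 * α := by
      simp only [← Finset.mul_sum]
      have h3 : ∀ u : Fin K, ∑ z, ∑ w : Fin L, atypMass pZ M (c (finProdFinEquiv (u, w))) z
          = ∑ w : Fin L, ∑ z, atypMass pZ M (c (finProdFinEquiv (u, w))) z :=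
        fun u => Finset.sum_comm
      have h4 := average_blocks (K := K) (L := L) fun i => ∑ z, atypMass pZ M (c i) z
      rw [← Finset.mul_sum] at h4
      simp only [h3]
      rw [h4, one_div_mul_eq_div, div_le_iff₀ hN]
      exact hc1
    gcongr

end Coding

/-- Numerical core of the union bound. -/
lemma union_bound_lt {C M β T K L η κ : ℝ} {n : ℕ} (hC : 0 ≤ C) (hM : 0 < M) (hβ : 0 < β)
    (hT : 0 < T) (hK : K ≤ 2 * 2 ^ n) (hη : 0 < η) (hκ : 0 < κ)
    (hκη : κ ≤ η / 2) (hκ1 : κ ≤ 1 / 2)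
    (hbase : (6 * C) ^ n * Real.exp (-(κ * T)) ≤ 1 / 16) (hLM : T ≤ L / M)
    (hKLM : T ≤ K * L / M) (hMβ : M * β * T ≤ 1) (hKLβ : K * L * β ≤ η / 4) :
    C ^ n * (K * Real.exp (-(2 * L / M)))
      + C ^ n * (3 ^ n * (Real.exp ((2 * (K * L) * β - η) / (M * β))
        + Real.exp (-(K * L * η / M)))) < 3 / 4 := by
  have t1 : Real.exp (-(2 * L / M)) ≤ Real.exp (-(κ * T)) := by
    refine Real.exp_le_exp.2 (neg_le_neg ?_)
    rw [mul_div_assoc]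
    exact mul_le_mul (by linarith) hLM hT.le two_pos.le
  have t2 : Real.exp ((2 * (K * L) * β - η) / (M * β)) ≤ Real.exp (-(κ * T)) := by
    refine Real.exp_le_exp.2 ?_
    rw [div_le_iff₀ (by positivity)]
    have h := mul_le_mul_of_nonneg_left hMβ hκ.le
    linarith
  have t3 : Real.exp (-(K * L * η / M)) ≤ Real.exp (-(κ * T)) := by
    refine Real.exp_le_exp.2 (neg_le_neg ?_)
    calc κ * T ≤ η * (K * L / M) := mul_le_mul (by linarith) hKLM hT.le hη.le
      _ = _ := by ring
  have hK6 : K ≤ 2 * 6 ^ n :=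
    hK.trans (mul_le_mul_of_nonneg_left (pow_le_pow_left₀ two_pos.le (by norm_num) n) two_pos.le)
  have hCn : 0 ≤ C ^ n := pow_nonneg hC n
  have h36 : (3 : ℝ) ^ n ≤ 6 ^ n := pow_le_pow_left₀ (by norm_num) (by norm_num) n
  set X := Real.exp (-(κ * T))
  have s1 : C ^ n * (K * Real.exp (-(2 * L / M))) ≤ 1 / 8 := by
    calc _ ≤ C ^ n * (2 * 6 ^ n * X) :=
          mul_le_mul_of_nonneg_left (mul_le_mul hK6 t1 (Real.exp_pos _).le (by positivity)) hCn
      _ = 2 * ((6 * C) ^ n * X) := by rw [mul_pow]; ring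
      _ ≤ _ := by linarith
  have s2 : C ^ n * (3 ^ n * (Real.exp ((2 * (K * L) * β - η) / (M * β))
      + Real.exp (-(K * L * η / M)))) ≤ 1 / 8 := by
    calc _ ≤ C ^ n * (6 ^ n * (X + X)) :=
          mul_le_mul_of_nonneg_left (mul_le_mul h36 (add_le_add t2 t3)
            (add_pos (Real.exp_pos _) (Real.exp_pos _)).le (by positivity)) hCn
      _ = 2 * ((6 * C) ^ n * X) := by rw [mul_pow]; ring
      _ ≤ _ := by linarith
  linarith

open Filter in
/-- The union bound over outputs, messages and states is eventually nontrivial. -/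
lemma eventually_union_bound (R I v δ C η : ℝ) (hR : 0 < R) (hI : 0 ≤ I) (hv : 0 ≤ v)
    (hδ : 0 < δ) (hsum : R + I + v + 5 * δ = 1) (hC : 0 ≤ C) (hη : 0 < η) :
    ∀ᶠ n : ℕ in atTop,
      C ^ n * ((⌈(2 : ℝ) ^ (n * R)⌉₊ : ℝ)
        * Real.exp (-(2 * (⌈(2 : ℝ) ^ (n * (I + 2 * δ))⌉₊ : ℝ) / 2 ^ (n * (I + δ)))))
      + C ^ n * (3 ^ n * (Real.exp ((2 * ((⌈(2 : ℝ) ^ (n * R)⌉₊ : ℝ)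
          * (⌈(2 : ℝ) ^ (n * (I + 2 * δ))⌉₊ : ℝ)) * 2 ^ (n * (v - 1)) - η)
            / (2 ^ (n * (I + δ)) * 2 ^ (n * (v - 1))))
        + Real.exp (-((⌈(2 : ℝ) ^ (n * R)⌉₊ : ℝ) * (⌈(2 : ℝ) ^ (n * (I + 2 * δ))⌉₊ : ℝ) * η
            / 2 ^ (n * (I + δ)))))) < 3 / 4 := by
  have hr : (1 : ℝ) < 2 ^ δ := Real.one_lt_rpow one_lt_two hδ
  set κ : ℝ := min η 1 / 2 with hκ
  have hκ0 : 0 < κ := by positivity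
  have hκη : κ ≤ η / 2 := by rw [hκ]; gcongr; exact min_le_left _ _
  have hκ1 : κ ≤ 1 / 2 := by rw [hκ]; gcongr; exact min_le_right _ _
  set Λ : ℝ := Real.log (6 * C + 1) with hΛ
  have hΛ0 : 0 ≤ Λ := Real.log_nonneg (by linarith)
  have hlim := tendsto_pow_const_div_const_pow_of_one_lt 1 hr
  have hev := hlim.eventually (Iic_mem_nhds (show (0 : ℝ) < κ / (Λ + 4) by positivity))
  filter_upwards [hev, eventually_ge_atTop 1, eventually_ge_atTop ⌈16 / η⌉₊] with n hn hn1 hn2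
  set T : ℝ := 2 ^ (n * δ) with hT
  have hpos : ∀ r : ℝ, (0 : ℝ) < 2 ^ r := fun r => Real.rpow_pos_of_pos two_pos r
  have hT0 : 0 < T := hpos _
  have hn0 : (1 : ℝ) ≤ n := by exact_mod_cast hn1
  have hn' : n * (Λ + 4) ≤ κ * T := by
    have : (n : ℝ) ^ 1 / ((2 : ℝ) ^ δ) ^ n ≤ κ / (Λ + 4) := hn
    rw [pow_one, ← Real.rpow_natCast ((2 : ℝ) ^ δ) n, ← Real.rpow_mul two_pos.le, mul_comm δ,
      div_le_div_iff₀ hT0 (by positivity)] at this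
    exact this
  have hTn : (n : ℝ) ≤ T := by nlinarith
  have hTη : 16 / η ≤ T := (Nat.ceil_le.1 hn2).trans hTn
  have hbase : (6 * C) ^ n * Real.exp (-(κ * T)) ≤ 1 / 16 := by
    have h1 : (6 * C) ^ n ≤ Real.exp (n * Λ) := by
      rw [Real.exp_nat_mul, hΛ, Real.exp_log (by linarith)]
      gcongr
      linarith
    have h16 : (16 : ℝ) ≤ Real.exp 4 := by
      have h2 : (2 : ℝ) ≤ Real.exp 1 := by
        have := Real.add_one_le_exp (1 : ℝ)
        linarith
      calc (16 : ℝ) = 2 ^ 4 := by norm_num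
        _ ≤ Real.exp 1 ^ 4 := by gcongr
        _ = _ := by rw [← Real.exp_nat_mul]; norm_num
    calc _ ≤ Real.exp (n * Λ) * Real.exp (-(κ * T)) := by gcongr
      _ = Real.exp (n * Λ - κ * T) := by rw [← Real.exp_add]; ring_nf
      _ ≤ Real.exp (-4) := by gcongr; nlinarith
      _ ≤ 1 / 16 := by
        rw [Real.exp_neg, one_div]
        gcongr
  have hceil : ∀ r : ℝ, 0 ≤ r → (⌈(2 : ℝ) ^ r⌉₊ : ℝ) ≤ 2 * 2 ^ r := fun r h => by
    have h1 : (1 : ℝ) ≤ 2 ^ r := Real.one_le_rpow one_le_two h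
    have h2 := (Nat.ceil_lt_add_one (hpos r).le).le
    linarith
  set M : ℝ := 2 ^ (n * (I + δ)) with hM
  set β : ℝ := 2 ^ (n * (v - 1)) with hβ
  set K : ℝ := (⌈(2 : ℝ) ^ (n * R)⌉₊ : ℝ) with hK
  set L : ℝ := (⌈(2 : ℝ) ^ (n * (I + 2 * δ))⌉₊ : ℝ) with hL
  have hM0 : 0 < M := hpos _
  have hβ0 : 0 < β := hpos _
  have hK1 : 1 ≤ K := (Real.one_le_rpow one_le_two (by positivity)).trans (Nat.le_ceil _)
  have hKu : K ≤ 2 * 2 ^ (n * R) := hceil _ (by positivity)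
  have hLu : L ≤ 2 * 2 ^ (n * (I + 2 * δ)) := hceil _ (by positivity)
  have hLM : T ≤ L / M := by
    rw [le_div_iff₀ hM0, hT, hM, ← Real.rpow_add two_pos]
    refine le_trans (le_of_eq ?_) (Nat.le_ceil _)
    congr 1
    ring
  have hKLM : T ≤ K * L / M := by
    rw [mul_div_assoc]
    exact hLM.trans (le_mul_of_one_le_left (hT0.le.trans hLM) hK1)
  have hMβ : M * β * T ≤ 1 := by
    rw [hM, hβ, hT, ← Real.rpow_add two_pos, ← Real.rpow_add two_pos]
    refine Real.rpow_le_one_of_one_le_of_nonpos one_le_two ?_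
    nlinarith
  have hKLβ : K * L * β * T ≤ 4 := by
    calc K * L * β * T ≤ (2 * 2 ^ (n * R)) * (2 * 2 ^ (n * (I + 2 * δ))) * β * T := by
          gcongr
      _ = 4 * (2 ^ (n * R) * 2 ^ (n * (I + 2 * δ)) * 2 ^ (n * (v - 1)) * 2 ^ (n * δ)) := by ring
      _ ≤ 4 * 1 := by
          rw [← Real.rpow_add two_pos, ← Real.rpow_add two_pos, ← Real.rpow_add two_pos]
          gcongr
          refine Real.rpow_le_one_of_one_le_of_nonpos one_le_two ?_
          nlinarith
      _ = 4 := mul_one 4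
  have hKLη : K * L * β ≤ η / 4 := by
    rw [div_le_iff₀ hη] at hTη
    have h1 : K * L * β * 16 ≤ 4 * η := by
      have h2 : 0 ≤ K * L * β := by positivity
      calc _ ≤ K * L * β * (T * η) := by gcongr
        _ = (K * L * β * T) * η := by ring
        _ ≤ _ := by gcongr
    linarith
  have hR1 : R ≤ 1 := by linarith
  have hK2 : K ≤ 2 * 2 ^ n := by
    refine hKu.trans ?_
    rw [← Real.rpow_natCast 2 n]
    gcongr
    · norm_num
    · nlinarith
  exact union_bound_lt hC hM0 hβ0 hT0 hK2 hη hκ0 hκη hκ1 hbase hLM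
    hKLM hMβ hKLη

open Filter in
/-- Secrecy rates below `H(X|Z)` minus the normalised log-volume of the adversary's ambiguity set. -/
lemma securelyAchievableCEF_of_lt {𝒵 : Type*} [Fintype 𝒵] (pZ : Bool → 𝒵 → ℝ)
    (hpZ : IsCondPMF pZ) (pe pw : ℝ) (hpe : 0 ≤ pe) (hpw : 0 ≤ pw)
    (hsum : pe + pw ≤ 1) (hhalf : pw / (1 - pe) ≤ 1 / 2) (R : ℝ)
    (hR : R < HXgZunif pZ + pe * binH (pw / (1 - pe)) - pe - binH (pw / (1 - pe))) :
    SecurelyAchievableCEF pZ pe pw R := by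
  rcases le_or_gt R 0 with hR0 | hR0
  · exact securelyAchievableCEF_of_nonpos hpZ pe pw hR0
  intro ε hε
  set v : ℝ := pe + (1 - pe) * binH (pw / (1 - pe)) with hv
  have hpe1 : 0 ≤ 1 - pe := by linarith
  have hv0 : 0 ≤ v := by
    have := binH_nonneg (div_nonneg hpw hpe1) (by linarith)
    positivity
  rw [HXgZunif_eq hpZ] at hR
  set I := unifInfo pZ with hI
  have hI0 : 0 ≤ I := unifInfo_nonneg hpZ
  obtain ⟨δ, hδ, hδsum⟩ : ∃ δ : ℝ, 0 < δ ∧ R + I + v + 5 * δ = 1 :=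
    ⟨(1 - R - I - v) / 5, by rw [hv]; linarith, by ring⟩
  obtain ⟨ρ, hρ0, hρ1, hρ⟩ := exists_sum_atypMass_le hpZ hδ
  have hα : (0 : ℝ) < ε / 16 := by positivity
  have hev1 := (tendsto_pow_atTop_nhds_zero_of_lt_one hρ0 hρ1).eventually (Iic_mem_nhds hα)
  have hev2 := eventually_union_bound R I v δ (Fintype.card 𝒵) (ε / 6) hR0 hI0 hv0 hδ hδsum
    (by positivity) (by positivity)
  obtain ⟨n, hn1, hn2, hn3, hn4⟩ :=
    (hev1.and (hev2.and ((eventually_ge_atTop 1).and (eventually_ge_atTop ⌈6 / ε⌉₊)))).exists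
  have hn1 : ρ ^ n ≤ ε / 16 := hn1
  have hpos : ∀ r : ℝ, (0 : ℝ) < 2 ^ r := fun r => Real.rpow_pos_of_pos two_pos r
  have hK : 0 < ⌈(2 : ℝ) ^ (n * R)⌉₊ := Nat.ceil_pos.2 (hpos _)
  have hL : 0 < ⌈(2 : ℝ) ^ (n * (I + 2 * δ))⌉₊ := Nat.ceil_pos.2 (hpos _)
  have hcard : (Fintype.card (Fin n → Bool) : ℝ) = 2 ^ n := by simp
  have hvol : ∀ y : Fin n → Option Bool, cnt (fun x => ∃ s, Adm pe pw s ∧ cefOut x s = y)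
      ≤ 2 ^ (n * (v - 1)) * (Fintype.card (Fin n → Bool) : ℝ) := fun y => by
    refine (cnt_cefOut_eq_le pe pw hpw hsum hhalf n y).trans (le_of_eq ?_)
    rw [hcard, ← Real.rpow_natCast 2 n, ← Real.rpow_add two_pos]
    congr 1
    ring
  obtain ⟨c, hc1, hc2, hc3⟩ := exists_codebook
    (fun (z : Fin n → 𝒵) x => typRatio pZ (2 ^ (n * (I + δ))) z x)
    (fun x => ∑ z, atypMass pZ (2 ^ (n * (I + δ))) x z)
    (fun s x x' => Confusable pe pw s x x') (2 ^ (n * (I + δ))) (2 ^ (n * (v - 1))) (ε / 16)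
    (ε / 6) _ _ hK hL (hpos _) (hpos _) hα
    (typRatio_nonneg hpZ _) (typRatio_le hpZ (hpos _).le)
    (fun z => by rw [hcard]; exact sum_typRatio_le hpZ _ z)
    (fun x => Finset.sum_nonneg fun z _ => atypMass_nonneg hpZ _ x z)
    (by
      rw [hcard]
      exact (hρ n).trans (by gcongr))
    (fun s x' => (cnt_mono fun x hx => by
      obtain ⟨_, s', hs', h⟩ := hx
      exact ⟨s', hs', cefOut_swap h⟩).trans (hvol (cefOut x' s)))
    (fun s x => (cnt_mono fun x' hx => hx.2).trans (hvol (cefOut x s)))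
    (by simpa using hn2)
  have hn0 : (0 : ℝ) < n := by exact_mod_cast hn3
  refine ⟨n, _, codeEnc hL c, firstDec pe pw hK c, hn3, hK, ?_, fun Jm => ?_, ?_⟩
  · rw [mul_comm]
    exact Nat.le_ceil _
  · have := avgErrCEF_le hpZ hK hL c hc1 hc3 Jm
    linarith
  · have h1 := miBits_jointUZ_le hpZ hK hL c hc1 hc2
    rw [one_div_mul_eq_div, div_le_iff₀ hn0]
    have h2 : 6 ≤ n * ε := (div_le_iff₀ hε).1 (Nat.ceil_le.1 hn4)
    nlinarith

/-- **Secrecy rates for the channel with erasing and flipping adversary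
`CEF(p_{Z|X}, p_e, p_w)`:** every secrecy rate below
`H(X|Z) + p_e·H(p_w/(1-p_e)) - p_e - H(p_w/(1-p_e))` is securely achievable; in
particular for `p_{Z|X} = BEC(q)` every secrecy rate below
`q + p_e·H(p_w/(1-p_e)) - p_e - H(p_w/(1-p_e))` is securely achievable. -/
theorem cef_secrecy_achievability {𝒵 : Type*} [Fintype 𝒵] (pZ : Bool → 𝒵 → ℝ)
    (hpZ : IsCondPMF pZ) (pe pw : ℝ) (hpe : 0 ≤ pe) (hpw : 0 ≤ pw)
    (hsum : pe + pw ≤ 1) (hhalf : pw / (1 - pe) ≤ 1 / 2) :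
    (∀ R : ℝ, R < HXgZunif pZ + pe * binH (pw / (1 - pe)) - pe - binH (pw / (1 - pe)) →
      SecurelyAchievableCEF pZ pe pw R) ∧
    (∀ q : ℝ, 0 ≤ q → q ≤ 1 →
      ∀ R : ℝ, R < q + pe * binH (pw / (1 - pe)) - pe - binH (pw / (1 - pe)) →
        SecurelyAchievableCEF (becChan q) pe pw R) := by
  refine ⟨fun R hR => securelyAchievableCEF_of_lt pZ hpZ pe pw hpe hpw hsum hhalf R hR,
    fun q h0 h1 R hR => ?_⟩
  exact securelyAchievableCEF_of_lt (becChan q) (isCondPMF_becChan h0 h1) pe pw hpe hpw hsum hhalf R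
    (by rwa [HXgZunif_becChan h0 h1])
end

section
/- Fix p ∈ (0, 1/2) and ε₁ > 0 with p + ε₁ < 1/2, and fix a rate R with 0 < R < 1 − H(p + ε₁). Let N = ⌈2^{nR}⌉ and let the code consist of N independent codewords, each uniformly distributed on {0,1}^n. Then there exist constants c > 0 and β > 0 such that for all sufficiently large n, with probability at least 1 − 2^{−β·n²}, every Hamming ball of radius ⌊(p+ε₁)·n⌋ in {0,1}^n contains at most c·n² codewords. -/
/-- The Hamming ball of radius `r` around `y` in `{0,1}^n`. -/
def hammingBall {n : ℕ} (y : Fin n → Bool) (r : ℕ) : Finset (Fin n → Bool) :=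
  {x | hammingDist x y ≤ r}

lemma sum_prod_bernoulli_eq_one {n : ℕ} (y : Fin n → Bool) (q : ℝ) :
    ∑ x : Fin n → Bool, ∏ i, (if x i ≠ y i then q else 1 - q) = 1 := by
  have h := Finset.prod_univ_sum (fun _ : Fin n => (Finset.univ : Finset Bool))
    (fun i b => if b ≠ y i then q else 1 - q)
  rw [Fintype.piFinset_univ] at h
  rw [← h]
  refine Finset.prod_eq_one fun i _ => ?_
  rw [Fintype.sum_bool]
  cases y i <;> simp

lemma two_rpow_neg_binH_le_prod {n : ℕ} (x y : Fin n → Bool) {q : ℝ} (hq0 : 0 < q)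
    (hq : q ≤ 1 / 2) (hd : (hammingDist x y : ℝ) ≤ q * n) :
    (2 : ℝ) ^ (-(n * binH q)) ≤ ∏ i, (if x i ≠ y i then q else 1 - q) := by
  rw [Finset.prod_ite, Finset.prod_const, Finset.prod_const]
  have hcard := Finset.card_filter_add_card_filter_not (s := (Finset.univ : Finset (Fin n)))
    (fun i => x i ≠ y i)
  rw [Finset.card_univ, Fintype.card_fin] at hcard
  change ((Finset.univ.filter fun i => x i ≠ y i).card : ℝ) ≤ q * n at hd
  generalize (Finset.univ.filter fun i => x i ≠ y i).card = d at *
  generalize (Finset.univ.filter fun i => ¬ x i ≠ y i).card = m at *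
  have hm : (m : ℝ) = n - d := by
    rw [← hcard]
    push_cast
    ring
  have hlog : Real.logb 2 q ≤ Real.logb 2 (1 - q) :=
    Real.logb_le_logb_of_le (by norm_num) hq0 (by linarith)
  have ha : (2 : ℝ) ^ Real.logb 2 q = q := Real.rpow_logb (by norm_num) (by norm_num) hq0
  have hb : (2 : ℝ) ^ Real.logb 2 (1 - q) = 1 - q :=
    Real.rpow_logb (by norm_num) (by norm_num) (by linarith)
  calc (2 : ℝ) ^ (-(n * binH q))
      ≤ (2 : ℝ) ^ (Real.logb 2 q * d + Real.logb 2 (1 - q) * m) := by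
        apply Real.rpow_le_rpow_of_exponent_le (by norm_num)
        rw [hm, binH]
        nlinarith [mul_nonneg (sub_nonneg.2 hd) (sub_nonneg.2 hlog)]
    _ = q ^ d * (1 - q) ^ m := by
        rw [Real.rpow_add (by norm_num), Real.rpow_mul (by norm_num),
          Real.rpow_mul (by norm_num), ha, hb, Real.rpow_natCast, Real.rpow_natCast]

/-- The entropy bound on the volume of a Hamming ball. -/
lemma card_hammingBall_le {n : ℕ} (y : Fin n → Bool) {q : ℝ} (hq0 : 0 < q) (hq : q ≤ 1 / 2) :
    ((hammingBall y ⌊q * n⌋₊).card : ℝ) ≤ (2 : ℝ) ^ (n * binH q) := by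
  have h : ((hammingBall y ⌊q * n⌋₊).card : ℝ) * (2 : ℝ) ^ (-(n * binH q)) ≤ 1 := by
    rw [← sum_prod_bernoulli_eq_one y q, ← nsmul_eq_mul]
    refine (Finset.card_nsmul_le_sum (hammingBall y ⌊q * n⌋₊) _ _ fun x hx => ?_).trans
      (Finset.sum_le_sum_of_subset_of_nonneg (Finset.subset_univ _) fun x _ _ => ?_)
    · have hx' : hammingDist x y ≤ ⌊q * n⌋₊ := by simpa [hammingBall] using hx
      exact two_rpow_neg_binH_le_prod x y hq0 hq ((Nat.le_floor_iff (by positivity)).1 hx')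
    · refine Finset.prod_nonneg fun i _ => ?_
      split_ifs <;> linarith
  rwa [Real.rpow_neg (by norm_num), ← div_eq_mul_inv, div_le_one (by positivity)] at h

/-- Union bound for the functions hitting `B` at least `k` times. -/
lemma card_filter_le_card_hits_mul {ι α : Type*} [Fintype ι] [DecidableEq ι] [Fintype α]
    [DecidableEq α] (B : Finset α) (k : ℕ) :
    (Finset.univ.filter fun C : ι → α => k ≤ (Finset.univ.filter fun w => C w ∈ B).card).card *
        Fintype.card α ^ k ≤
      Fintype.card ι ^ k * B.card ^ k * Fintype.card α ^ Fintype.card ι := by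
  have hsub : (Finset.univ.filter fun C : ι → α =>
      k ≤ (Finset.univ.filter fun w => C w ∈ B).card) ⊆
      (Finset.univ.powersetCard k).biUnion fun S : Finset ι =>
        Fintype.piFinset fun w => if w ∈ S then B else Finset.univ := by
    intro C hC
    obtain ⟨S, hS, hSk⟩ := Finset.exists_subset_card_eq (Finset.mem_filter.1 hC).2
    refine Finset.mem_biUnion.2
      ⟨S, Finset.mem_powersetCard.2 ⟨Finset.subset_univ _, hSk⟩, Fintype.mem_piFinset.2 fun w => ?_⟩
    split_ifs with hw
    · exact (Finset.mem_filter.1 (hS hw)).2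
    · exact Finset.mem_univ _
  have hterm : ∀ S ∈ (Finset.univ : Finset ι).powersetCard k,
      (Fintype.piFinset fun w => if w ∈ S then B else Finset.univ).card * Fintype.card α ^ k =
        B.card ^ k * Fintype.card α ^ Fintype.card ι := by
    intro S hS
    have hSk := (Finset.mem_powersetCard.1 hS).2
    have hkι : k ≤ Fintype.card ι := hSk ▸ S.card_le_univ
    have hcompl : (Finset.univ.filter fun w => w ∉ S).card = Fintype.card ι - k := by
      rw [← hSk, ← Finset.card_compl]
      congr 1
      ext w
      simp
    simp only [Fintype.card_piFinset, apply_ite Finset.card, Finset.prod_ite, Finset.prod_const,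
      hcompl, Finset.filter_mem_eq_inter, Finset.univ_inter, hSk, Finset.card_univ]
    rw [mul_assoc, ← pow_add, Nat.sub_add_cancel hkι]
  calc _ ≤ (∑ S ∈ (Finset.univ : Finset ι).powersetCard k,
        (Fintype.piFinset fun w => if w ∈ S then B else Finset.univ).card) *
          Fintype.card α ^ k :=
        Nat.mul_le_mul_right _ ((Finset.card_le_card hsub).trans Finset.card_biUnion_le)
    _ = (Fintype.card ι).choose k * (B.card ^ k * Fintype.card α ^ Fintype.card ι) := by
        rw [Finset.sum_mul, Finset.sum_congr rfl hterm, Finset.sum_const,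
          Finset.card_powersetCard, Finset.card_univ, smul_eq_mul]
    _ ≤ _ := by
        rw [← mul_assoc]
        gcongr
        exact Nat.choose_le_pow _ _

/-- The number of codes for which some Hamming ball of radius `r` contains at least `k`
codewords, when every such ball has at most `V` elements. -/
lemma card_crowded_codes_mul_le {N n r k : ℕ} {V : ℝ}
    (hV : ∀ y : Fin n → Bool, ((hammingBall y r).card : ℝ) ≤ V) :
    ((Finset.univ.filter fun C : Fin N → Fin n → Bool => ∃ y : Fin n → Bool,
        k ≤ (Finset.univ.filter fun w => C w ∈ hammingBall y r).card).card : ℝ) * (2 ^ n) ^ k ≤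
      2 ^ n * ((N * V) ^ k * (2 ^ n) ^ N) := by
  have hsub : (Finset.univ.filter fun C : Fin N → Fin n → Bool => ∃ y : Fin n → Bool,
      k ≤ (Finset.univ.filter fun w => C w ∈ hammingBall y r).card) ⊆
      Finset.univ.biUnion fun y : Fin n → Bool => Finset.univ.filter
        fun C : Fin N → Fin n → Bool =>
          k ≤ (Finset.univ.filter fun w => C w ∈ hammingBall y r).card := by
    intro C hC
    obtain ⟨y, hy⟩ := (Finset.mem_filter.1 hC).2
    exact Finset.mem_biUnion.2
      ⟨y, Finset.mem_univ _, Finset.mem_filter.2 ⟨Finset.mem_univ _, hy⟩⟩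
  have hcard : (((Finset.univ.filter fun C : Fin N → Fin n → Bool => ∃ y : Fin n → Bool,
      k ≤ (Finset.univ.filter fun w => C w ∈ hammingBall y r).card).card : ℕ) : ℝ) ≤
      ∑ y : Fin n → Bool, ((Finset.univ.filter fun C : Fin N → Fin n → Bool =>
          k ≤ (Finset.univ.filter fun w => C w ∈ hammingBall y r).card).card : ℝ) := by
    exact_mod_cast (Finset.card_le_card hsub).trans Finset.card_biUnion_le
  refine (mul_le_mul_of_nonneg_right hcard (by positivity)).trans ?_
  rw [Finset.sum_mul]
  refine (Finset.sum_le_card_nsmul _ _ ((N * V) ^ k * (2 ^ n) ^ N) fun y _ => ?_).trans ?_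
  · have h := card_filter_le_card_hits_mul (ι := Fin N) (hammingBall y r) k
    simp only [Fintype.card_pi, Fintype.card_bool, Finset.prod_const, Finset.card_univ,
      Fintype.card_fin] at h
    have h' : ((Finset.univ.filter fun C : Fin N → Fin n → Bool =>
        k ≤ (Finset.univ.filter fun w => C w ∈ hammingBall y r).card).card : ℝ) * (2 ^ n) ^ k ≤
        N ^ k * (hammingBall y r).card ^ k * (2 ^ n) ^ N := by
      exact_mod_cast h
    refine h'.trans ?_
    rw [mul_pow]
    gcongr
    exact hV y
  · simp

/-- The union bound over balls and `n ^ 2`-element lists is at most `2 ^ (-n ^ 2)`. -/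
lemma union_bound_le_two_rpow {n : ℕ} {N V R h δ : ℝ} (hδ : 0 < δ) (hRh : R + h + δ = 1)
    (hn : 4 / δ ≤ n) (hN0 : 0 ≤ N) (hN : N ≤ 2 * (2 : ℝ) ^ (R * n))
    (hV0 : 0 ≤ V) (hV : V ≤ (2 : ℝ) ^ (n * h)) :
    2 ^ n * (N * V / 2 ^ n) ^ n ^ 2 ≤ (2 : ℝ) ^ (-1 * (n : ℝ) ^ 2) := by
  have hδn : 4 ≤ δ * n := by rwa [div_le_iff₀' hδ] at hn
  have hn0 : n ≠ 0 := by
    rintro rfl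
    norm_num at hδn
  have hn1 : (1 : ℝ) ≤ n := by exact_mod_cast Nat.one_le_iff_ne_zero.2 hn0
  have hbase : N * V / 2 ^ n ≤ (2 : ℝ) ^ (-2 : ℝ) := by
    rw [div_le_iff₀ (by positivity)]
    calc N * V ≤ 2 * (2 : ℝ) ^ (R * n) * (2 : ℝ) ^ (n * h) := by gcongr
      _ = (2 : ℝ) ^ (1 + R * n + n * h) := by
        rw [Real.rpow_add (by norm_num), Real.rpow_add (by norm_num), Real.rpow_one]
      _ ≤ (2 : ℝ) ^ ((-2 : ℝ) + n) := by
        apply Real.rpow_le_rpow_of_exponent_le (by norm_num)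
        have : h = 1 - R - δ := by linarith
        rw [this]
        nlinarith
      _ = (2 : ℝ) ^ (-2 : ℝ) * 2 ^ n := by
        rw [Real.rpow_add (by norm_num), Real.rpow_natCast]
  calc 2 ^ n * (N * V / 2 ^ n) ^ n ^ 2
      ≤ 2 ^ n * ((2 : ℝ) ^ (-2 : ℝ)) ^ n ^ 2 := by gcongr
    _ = (2 : ℝ) ^ (n + -2 * (n : ℝ) ^ 2) := by
        rw [Real.rpow_add (by norm_num), Real.rpow_mul (by norm_num), Real.rpow_natCast]
        norm_cast
    _ ≤ _ := by
        apply Real.rpow_le_rpow_of_exponent_le (by norm_num)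
        nlinarith

/-- **Random codes are list decodable with polynomial list size (Corollary 5 of the
paper).** -/
theorem random_code_ball_list_decoding (p ε₁ R : ℝ) (hp0 : 0 < p) (hp : p < 1 / 2)
    (hε₁ : 0 < ε₁) (hpe : p + ε₁ < 1 / 2) (hR0 : 0 < R) (hR : R < 1 - binH (p + ε₁)) :
    ∃ c : ℝ, 0 < c ∧ ∃ β : ℝ, 0 < β ∧ ∃ n₀ : ℕ, ∀ n : ℕ, n₀ ≤ n →
      1 - (2 : ℝ) ^ (-β * (n : ℝ) ^ 2) ≤
        (Nat.card {C : Fin ⌈(2 : ℝ) ^ (R * n)⌉₊ → Fin n → Bool //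
            ∀ y : Fin n → Bool,
              (Nat.card {w : Fin ⌈(2 : ℝ) ^ (R * n)⌉₊ //
                  hammingDist (C w) y ≤ ⌊(p + ε₁) * n⌋₊} : ℝ) ≤ c * (n : ℝ) ^ 2} : ℝ) /
          (Nat.card (Fin ⌈(2 : ℝ) ^ (R * n)⌉₊ → Fin n → Bool) : ℝ) := by
  have hδ : 0 < 1 - binH (p + ε₁) - R := by linarith
  refine ⟨1, one_pos, 1, one_pos, ⌈4 / (1 - binH (p + ε₁) - R)⌉₊, fun n hn => ?_⟩
  have hn' := Nat.ceil_le.1 hn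
  set N := ⌈(2 : ℝ) ^ (R * n)⌉₊ with hNdef
  have hN : (N : ℝ) ≤ 2 * (2 : ℝ) ^ (R * n) := by
    have h1 : (1 : ℝ) ≤ (2 : ℝ) ^ (R * n) := Real.one_le_rpow (by norm_num) (by positivity)
    have h2 := Nat.ceil_lt_add_one (zero_le_one.trans h1)
    linarith
  have hcrowded := card_crowded_codes_mul_le (N := N) (k := n ^ 2)
    fun y : Fin n → Bool => card_hammingBall_le y (add_pos hp0 hε₁) hpe.le
  have hbound := union_bound_le_two_rpow hδ (by ring) hn' N.cast_nonneg hN (by positivity)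
    (le_refl ((2 : ℝ) ^ (n * binH (p + ε₁))))
  have htotal : Nat.card (Fin N → Fin n → Bool) = (2 ^ n) ^ N := by
    simp [Nat.card_eq_fintype_card]
  set bad := Finset.univ.filter fun C : Fin N → Fin n → Bool => ∃ y : Fin n → Bool,
    n ^ 2 ≤ (Finset.univ.filter fun w => C w ∈ hammingBall y ⌊(p + ε₁) * n⌋₊).card
  have hgood : (2 ^ n) ^ N - (bad.card : ℝ) ≤
      (Nat.card {C : Fin N → Fin n → Bool // ∀ y : Fin n → Bool,
        (Nat.card {w : Fin N // hammingDist (C w) y ≤ ⌊(p + ε₁) * n⌋₊} : ℝ) ≤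
          1 * (n : ℝ) ^ 2} : ℝ) := by
    have hcompl := Finset.card_compl_add_card bad
    rw [← Nat.card_eq_fintype_card, htotal] at hcompl
    have hle : (badᶜ).card ≤ Nat.card {C : Fin N → Fin n → Bool // ∀ y : Fin n → Bool,
        (Nat.card {w : Fin N // hammingDist (C w) y ≤ ⌊(p + ε₁) * n⌋₊} : ℝ) ≤
          1 * (n : ℝ) ^ 2} := by
      classical
      rw [Nat.card_eq_fintype_card, Fintype.card_subtype]
      refine Finset.card_le_card fun C hC => Finset.mem_filter.2 ⟨Finset.mem_univ _, fun y => ?_⟩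
      by_contra! hlt
      refine Finset.mem_compl.1 hC (Finset.mem_filter.2 ⟨Finset.mem_univ _, y, ?_⟩)
      rw [one_mul, Nat.card_eq_fintype_card, Fintype.card_subtype] at hlt
      have hlt' := hlt.le
      simp only [hammingBall, Finset.mem_filter, Finset.mem_univ, true_and]
      exact_mod_cast hlt'
    have hcompl' : ((badᶜ).card : ℝ) + bad.card = (2 ^ n) ^ N := by exact_mod_cast hcompl
    have hle' : ((badᶜ).card : ℝ) ≤ _ := Nat.cast_le.2 hle
    linarith
  have hbad : (bad.card : ℝ) ≤ (2 : ℝ) ^ (-1 * (n : ℝ) ^ 2) * (2 ^ n) ^ N := by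
    rw [← le_div_iff₀ (by positivity)] at hcrowded
    refine hcrowded.trans (le_trans (le_of_eq ?_)
      (mul_le_mul_of_nonneg_right hbound (by positivity)))
    rw [div_pow]
    ring
  rw [htotal, le_div_iff₀ (by positivity)]
  push_cast
  linarith
end
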